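/- Let 1 ≤ d < N be integers, A ∈ ℝ^{d×(N−d)}, α₀ ∈ ℝ^{N−d}, and let Ã ∈ ℝ^{(d+1)×(N−d)} be the matrix with first row α₀ and remaining rows those of A. Assume Ã is φ̃-semi multiplicatively badly approximable, where φ̃ : [1,∞) → (0,1] is non-increasing and for every λ ≥ 1 there is c_λ > 0 with φ̃(λx) ≥ c_λ φ̃(x) for all x ≥ 1. Then for every ε' > 0 there is a constant C > 0, depending only on ε', N, d and φ̃, such that for every integer Q ≥ 1 and every 0 < δ < 1/2: |𝒩(Q,δ) − 2^{N−d} δ^{N−d} Σ_{q=1}^Q q^d| ≤ ε' δ^{N−d} Q^{d+1} + C · [ (log((1/δ^{N−d})/φ̃(1/δ)))^{d+1} + (1/φ̃(1/δ)) · (log((1/δ^{N−d})/φ̃(1/δ)))^d ]. -/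

import Mathlib

open scoped BigOperators

/-- distance from a real number to the nearest integer -/
noncomputable def distNearestInt (x : ℝ) : ℝ := |x - (round x : ℤ)|

/-- the sup norm `|q|_∞` of an integer vector, as a real number -/
noncomputable def intSupNorm {k : ℕ} (q : Fin k → ℤ) : ℝ := ‖(fun j => (q j : ℝ))‖

section LatticePoints

open MeasureTheory

/-- If the points of a lattice in the unit ball span the space, their number is at most a constant
times the reciprocal of the volume of any set whose lattice translates are disjoint. -/
theorem card_mul_volume_le_of_span_eq_top {ι : Type*} [Fintype ι] (Λ : AddSubgroup (ι → ℝ))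
    [Countable Λ] {F : Set (ι → ℝ)} (hF : MeasurableSet F)
    (hdisj : ∀ x ∈ F, ∀ y ∈ F, x - y ∈ Λ → x = y)
    (hspan : Submodule.span ℝ ((Λ : Set (ι → ℝ)) ∩ Metric.closedBall 0 1) = ⊤)
    (S : Finset (ι → ℝ)) (hS : ∀ s ∈ S, s ∈ Λ ∧ ‖s‖ ≤ 1) :
    (S.card : ENNReal) * volume F ≤
      ENNReal.ofReal ((2 * (Fintype.card ι + 1)) ^ Fintype.card ι) := by
  classical
  set D := Fintype.card ι
  obtain ⟨b, hb⟩ : ∃ b : Module.Basis ι ℝ (ι → ℝ), ∀ i, b i ∈ Λ ∧ ‖b i‖ ≤ 1 := by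
    let b₀ := Module.Basis.ofSpan hspan.ge
    have e := b₀.indexEquiv (Pi.basisFun ℝ ι)
    refine ⟨b₀.reindex e, fun i => ?_⟩
    have : b₀ (e.symm i) ∈ (Λ : Set (ι → ℝ)) ∩ Metric.closedBall 0 1 :=
      Module.Basis.ofSpan_subset hspan.ge (Set.mem_range_self _)
    simpa using this
  have hred : ∀ y : ι → ℝ, ∃ v ∈ Λ, ‖y + v‖ ≤ D := by
    intro y
    refine ⟨-(ZSpan.floor b y : ι → ℝ), ?_, ?_⟩
    · refine Λ.neg_mem ?_
      have h : Submodule.span ℤ (Set.range b) ≤ AddSubgroup.toIntSubmodule Λ := by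
        rw [Submodule.span_le]
        rintro _ ⟨i, rfl⟩
        exact (hb i).1
      exact h (ZSpan.floor b y).2
    · rw [← sub_eq_add_neg, ← ZSpan.fract_apply]
      refine (ZSpan.norm_fract_le b y).trans ?_
      refine (Finset.sum_le_sum fun i _ => (hb i).2).trans ?_
      simp [D]
  set B : Set (ι → ℝ) := Metric.closedBall 0 (D + 1)
  have hBm : MeasurableSet B := Metric.isClosed_closedBall.measurableSet
  have hpt : ∀ y, (S.card : ENNReal) ≤ ∑' v : Λ, B.indicator 1 (y + (v : ι → ℝ)) := by
    intro y
    obtain ⟨v, hv, hy⟩ := hred y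
    let g : S → Λ := fun s => ⟨v + s, Λ.add_mem hv (hS s s.2).1⟩
    have hg : Function.Injective g := by
      intro s t hst
      exact Subtype.ext (add_left_cancel (congrArg Subtype.val hst))
    calc (S.card : ENNReal) = ∑' s : S, (1 : ENNReal) := by
          rw [tsum_fintype]; simp
      _ ≤ ∑' s : S, B.indicator 1 (y + (g s : ι → ℝ)) := by
          refine ENNReal.tsum_le_tsum fun s => ?_
          rw [Set.indicator_of_mem]
          · simp
          · simp only [B, g, mem_closedBall_zero_iff]
            rw [← add_assoc]
            exact (norm_add_le _ _).trans (add_le_add hy (hS s s.2).2)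
      _ ≤ _ := ENNReal.tsum_comp_le_tsum_of_injective hg _
  have hcount : (S.card : ENNReal) * volume F ≤
      ∑' v : Λ, volume (B ∩ (fun x => x - (v : ι → ℝ)) ⁻¹' F) := by
    calc (S.card : ENNReal) * volume F = ∫⁻ _ in F, (S.card : ENNReal) := by simp
      _ ≤ ∫⁻ y in F, ∑' v : Λ, B.indicator 1 (y + (v : ι → ℝ)) := lintegral_mono fun y => hpt y
      _ = ∑' v : Λ, ∫⁻ y in F, B.indicator 1 (y + (v : ι → ℝ)) := by
          refine lintegral_tsum fun v => Measurable.aemeasurable ?_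
          exact (measurable_one.indicator hBm).comp (measurable_add_const _)
      _ = ∑' v : Λ, volume (B ∩ (fun x => x - (v : ι → ℝ)) ⁻¹' F) := by
          refine tsum_congr fun v => ?_
          have h1 : ∀ y, B.indicator (1 : (ι → ℝ) → ENNReal) (y + (v : ι → ℝ)) =
            ((fun x => x + (v : ι → ℝ)) ⁻¹' B).indicator 1 y := fun y => rfl
          simp_rw [h1]
          have hm : MeasurableSet ((fun x => x + (v : ι → ℝ)) ⁻¹' B) := (measurable_add_const _) hBm
          rw [lintegral_indicator_one hm, Measure.restrict_apply hm,
            ← measure_preimage_add_right volume (v : ι → ℝ)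
              (B ∩ (fun x => x - (v : ι → ℝ)) ⁻¹' F)]
          congr 1
          ext y
          simp
  refine hcount.trans ?_
  rw [← measure_iUnion]
  · refine (measure_mono (Set.iUnion_subset fun v => Set.inter_subset_left)).trans ?_
    rw [Real.volume_pi_closedBall _ (by positivity)]
  · intro v w hvw
    refine Set.disjoint_left.2 ?_
    rintro x ⟨-, hx⟩ ⟨-, hx'⟩
    refine hvw (Subtype.ext ?_)
    have := hdisj _ hx _ hx' (by
      have : x - (v : ι → ℝ) - (x - w) = w - v := by abel
      rw [this]
      exact Λ.sub_mem w.2 v.2)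
    simpa using this
  · exact fun v => hBm.inter ((measurable_sub_const _) hF)

/-- If the lattice points in the unit ball do not span the space, and the nonzero ones have norm at
least `ℓ`, then their number is `O(ℓ ^ (1 - D))` in dimension `D`. -/
theorem card_le_of_span_ne_top {ι : Type*} [Fintype ι] (Λ : AddSubgroup (ι → ℝ))
    (hspan : Submodule.span ℝ ((Λ : Set (ι → ℝ)) ∩ Metric.closedBall 0 1) ≠ ⊤)
    {ℓ : ℝ} (hℓ : 0 < ℓ) (hℓ1 : ℓ ≤ 1) (hmin : ∀ v ∈ Λ, v ≠ 0 → ℓ ≤ ‖v‖)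
    (S : Finset (ι → ℝ)) (hS : ∀ s ∈ S, s ∈ Λ ∧ ‖s‖ ≤ 1) :
    (S.card : ℝ) ≤ (5 * Fintype.card ι / ℓ) ^ (Fintype.card ι - 1) := by
  classical
  set D := Fintype.card ι with hD
  obtain ⟨f, hf0, hf⟩ := Submodule.exists_le_ker_of_lt_top _ (lt_top_iff_ne_top.2 hspan)
  have hne : Nonempty ι := by
    by_contra h
    rw [not_nonempty_iff] at h
    exact hf0 (LinearMap.ext fun x => by rw [Subsingleton.elim x 0]; simp)
  have hDpos : 0 < D := Fintype.card_pos
  set c : ι → ℝ := fun i => f (Pi.single i 1) with hc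
  have hfc : ∀ x, f x = ∑ i, x i * c i := by
    intro x
    conv_lhs => rw [← Finset.univ_sum_single x]
    rw [map_sum]
    refine Finset.sum_congr rfl fun i _ => ?_
    rw [hc]
    have : (Pi.single i (x i) : ι → ℝ) = x i • Pi.single i 1 := by
      rw [← Pi.single_smul]; simp
    rw [this, map_smul, smul_eq_mul]
  obtain ⟨i₀, -, hi₀⟩ := Finset.exists_max_image Finset.univ (fun i => |c i|) Finset.univ_nonempty
  have hci₀ : 0 < |c i₀| := by
    rw [abs_pos]
    intro h
    refine hf0 (LinearMap.ext fun x => ?_)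
    rw [hfc]
    refine Finset.sum_eq_zero fun i _ => ?_
    have := hi₀ i (Finset.mem_univ _)
    rw [h, abs_zero] at this
    rw [abs_nonpos_iff.1 this, mul_zero]
  have hker : ∀ x, f x = 0 → |x i₀| ≤ ∑ i ∈ Finset.univ.erase i₀, |x i| := by
    intro x hx
    rw [hfc, ← Finset.add_sum_erase _ _ (Finset.mem_univ i₀)] at hx
    have h1 : |x i₀| * |c i₀| ≤ (∑ i ∈ Finset.univ.erase i₀, |x i|) * |c i₀| := by
      rw [← abs_mul, eq_neg_of_add_eq_zero_left hx, abs_neg, Finset.sum_mul]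
      refine (Finset.abs_sum_le_sum_abs _ _).trans (Finset.sum_le_sum fun i _ => ?_)
      rw [abs_mul]
      exact mul_le_mul_of_nonneg_left (hi₀ i (Finset.mem_univ _)) (abs_nonneg _)
    exact le_of_mul_le_mul_right h1 hci₀
  have hDr : (0 : ℝ) < D := by exact_mod_cast hDpos
  set R : ℤ := ⌈D / ℓ⌉
  let g : (ι → ℝ) → ({i // i ≠ i₀} → ℤ) := fun x i => ⌊x i * (D / ℓ)⌋
  have hinj : Set.InjOn g S := by
    intro x hx y hy hxy
    by_contra hne
    have hw : x - y ∈ Λ := Λ.sub_mem (hS x hx).1 (hS y hy).1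
    have hfx : ∀ z ∈ S, f z = 0 := fun z hz =>
      hf (Submodule.subset_span ⟨(hS z hz).1, by simpa using (hS z hz).2⟩)
    have hfw : f (x - y) = 0 := by rw [map_sub, hfx x hx, hfx y hy, sub_zero]
    have hsmall : ∀ i, i ≠ i₀ → |(x - y) i| < ℓ / D := by
      intro i hi
      have h1 := Int.abs_sub_lt_one_of_floor_eq_floor (congrFun hxy ⟨i, hi⟩)
      simp only at h1
      rw [← sub_mul, abs_mul, abs_of_pos (show 0 < (D : ℝ) / ℓ by positivity)] at h1
      rw [Pi.sub_apply, lt_div_iff₀ hDr]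
      rw [← mul_div_assoc, div_lt_one hℓ] at h1
      exact h1
    have hlt : ‖x - y‖ < ℓ := by
      rw [pi_norm_lt_iff hℓ]
      intro i
      have hle : ℓ / D ≤ ℓ := div_le_self hℓ.le (by exact_mod_cast hDpos)
      by_cases hi : i = i₀
      · subst hi
        refine (hker _ hfw).trans_lt ?_
        refine (Finset.sum_le_sum fun j hj => (hsmall j (Finset.ne_of_mem_erase hj)).le).trans_lt ?_
        rw [Finset.sum_const, Finset.card_erase_of_mem (Finset.mem_univ _), Finset.card_univ,
          nsmul_eq_mul, ← hD, Nat.cast_sub hDpos, sub_mul, mul_div_cancel₀ _ hDr.ne']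
        simp only [Nat.succ_eq_add_one, zero_add, Nat.cast_one, one_mul]
        have : 0 < ℓ / D := by positivity
        linarith
      · exact (hsmall i hi).trans_le hle
    exact absurd (hmin _ hw (sub_ne_zero.2 hne)) (not_le.2 hlt)
  have hmaps : ∀ x ∈ S, g x ∈ Fintype.piFinset fun _ : {i // i ≠ i₀} => Finset.Icc (-R) R := by
    intro x hx
    rw [Fintype.mem_piFinset]
    intro i
    have h1 : |x i| ≤ 1 := (norm_le_pi_norm x i).trans (hS x hx).2
    rw [abs_le] at h1
    have hpos : 0 < (D : ℝ) / ℓ := by positivity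
    have hR : (D : ℝ) / ℓ ≤ R := Int.le_ceil _
    rw [Finset.mem_Icc]
    constructor
    · rw [Int.le_floor]; push_cast; nlinarith
    · have : x i * (D / ℓ) ≤ R := by nlinarith
      exact_mod_cast (Int.floor_le _).trans this
  have hcard := Finset.card_le_card_of_injOn g hmaps hinj
  rw [Fintype.card_piFinset, Finset.prod_const, Finset.card_univ, Int.card_Icc,
    Fintype.card_subtype_compl,
    Fintype.card_subtype_eq, ← hD] at hcard
  refine (Nat.cast_le (α := ℝ).2 hcard).trans ?_
  push_cast
  refine pow_le_pow_left₀ (by positivity) ?_ _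
  have hD1 : 1 ≤ (D : ℝ) / ℓ := by
    rw [le_div_iff₀ hℓ]
    have : (1 : ℝ) ≤ D := by exact_mod_cast hDpos
    linarith
  have hR1 : (R : ℝ) < D / ℓ + 1 := Int.ceil_lt_add_one _
  have hR0 : 0 ≤ R := Int.ceil_nonneg (by positivity)
  have : ((R + 1 - -R).toNat : ℝ) = 2 * R + 1 := by
    have : (((R + 1 - -R).toNat : ℤ) : ℝ) = ((R + 1 - -R : ℤ) : ℝ) := by
      rw [Int.toNat_of_nonneg (by omega)]
    push_cast at this
    rw [this]; ring
  rw [this, mul_div_assoc]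
  linarith

/-- The linear forms `k ↦ Σ_j Θ_{ij} k_j` given by the rows of a matrix. -/
noncomputable def linForm {M n : ℕ} (Θ : Matrix (Fin M) (Fin n) ℝ) (k : Fin n → ℤ)
    (i : Fin M) : ℝ :=
  ∑ j, Θ i j * (k j : ℝ)

/-- `Θ` is `φ`-semi multiplicatively badly approximable. -/
def SemiMultBad {M n : ℕ} (φ : ℝ → ℝ) (Θ : Matrix (Fin M) (Fin n) ℝ) : Prop :=
  ∀ k : Fin n → ℤ, k ≠ 0 → φ (intSupNorm k) ≤ intSupNorm k ^ n * ∏ i, distNearestInt (linForm Θ k i)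

theorem linForm_add {M n : ℕ} (Θ : Matrix (Fin M) (Fin n) ℝ) (k l : Fin n → ℤ) (i : Fin M) :
    linForm Θ (k + l) i = linForm Θ k i + linForm Θ l i := by
  simp [linForm, mul_add, Finset.sum_add_distrib]

theorem linForm_zero {M n : ℕ} (Θ : Matrix (Fin M) (Fin n) ℝ) (i : Fin M) :
    linForm Θ 0 i = 0 := by
  simp [linForm]

theorem distNearestInt_nonneg (x : ℝ) : 0 ≤ distNearestInt x := abs_nonneg _

theorem distNearestInt_le_abs_sub (x : ℝ) (p : ℤ) : distNearestInt x ≤ |x - p| := round_le x p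

theorem distNearestInt_le_half (x : ℝ) : distNearestInt x ≤ 1 / 2 := abs_sub_round x

theorem one_le_intSupNorm {n : ℕ} {k : Fin n → ℤ} (hk : k ≠ 0) : 1 ≤ intSupNorm k := by
  obtain ⟨j, hj⟩ := Function.ne_iff.1 hk
  refine le_trans ?_ (norm_le_pi_norm (fun j => (k j : ℝ)) j)
  rw [Real.norm_eq_abs]
  exact_mod_cast Int.one_le_abs hj

/-- The lattice `{(k / K, (Θ k - p) / r)}`. -/
noncomputable def scaledLatticeHom {M n : ℕ} (Θ : Matrix (Fin M) (Fin n) ℝ) (K : ℝ)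
    (r : Fin M → ℝ) : (Fin n → ℤ) × (Fin M → ℤ) →+ (Fin n ⊕ Fin M → ℝ) where
  toFun x := Sum.elim (fun j => x.1 j / K) (fun i => (linForm Θ x.1 i - x.2 i) / r i)
  map_zero' := by
    ext (j | i) <;> simp [linForm_zero]
  map_add' x y := by
    ext (j | i)
    · simp [add_div]
    · simp only [Prod.fst_add, Prod.snd_add, linForm_add, Pi.add_apply, Sum.elim_inr]
      push_cast
      ring

theorem le_norm_scaledLatticeHom {M n : ℕ} (hn : 1 ≤ n) {φ : ℝ → ℝ}
    (hφmono : ∀ x y, 1 ≤ x → x ≤ y → φ y ≤ φ x)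
    {Θ : Matrix (Fin M) (Fin n) ℝ} (hΘ : SemiMultBad φ Θ) {K : ℝ} (hK : 1 ≤ K) {r : Fin M → ℝ}
    (hr : ∀ i, 0 < r i) (hr2 : ∀ i, r i ≤ 1 / 2) {ℓ : ℝ} (hℓ0 : 0 < ℓ) (hℓ1 : ℓ ≤ 1)
    (hℓ : ℓ ^ (n + M) * (K ^ n * ∏ i, r i) ≤ φ K)
    (x : (Fin n → ℤ) × (Fin M → ℤ)) (hx : scaledLatticeHom Θ K r x ≠ 0) :
    ℓ ≤ ‖scaledLatticeHom Θ K r x‖ := by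
  by_contra! hlt
  set t := ‖scaledLatticeHom Θ K r x‖ with ht
  have hK0 : 0 < K := by linarith
  have ht0 : 0 ≤ t := norm_nonneg _
  have h1 : ∀ j, |(x.1 j : ℝ)| ≤ t * K := by
    intro j
    have := norm_le_pi_norm (scaledLatticeHom Θ K r x) (Sum.inl j)
    simp only [scaledLatticeHom, AddMonoidHom.coe_mk, ZeroHom.coe_mk, Sum.elim_inl,
      Real.norm_eq_abs, abs_div, abs_of_pos hK0] at this
    rwa [div_le_iff₀ hK0] at this
  have h2 : ∀ i, |linForm Θ x.1 i - x.2 i| ≤ t * r i := by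
    intro i
    have := norm_le_pi_norm (scaledLatticeHom Θ K r x) (Sum.inr i)
    simp only [scaledLatticeHom, AddMonoidHom.coe_mk, ZeroHom.coe_mk, Sum.elim_inr,
      Real.norm_eq_abs, abs_div, abs_of_pos (hr i)] at this
    rwa [div_le_iff₀ (hr i)] at this
  have hk : x.1 ≠ 0 := by
    intro hk
    refine hx ?_
    have hp : x.2 = 0 := by
      ext i
      have := h2 i
      rw [hk, linForm_zero, zero_sub, abs_neg] at this
      have h3 : |(x.2 i : ℝ)| < 1 := by nlinarith [hr i, hr2 i]
      have h4 : |x.2 i| < 1 := by exact_mod_cast h3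
      simpa using Int.abs_lt_one_iff.1 h4
    rw [show x = 0 from Prod.ext hk hp, map_zero]
  have hnorm1 := one_le_intSupNorm hk
  have hnorm : intSupNorm x.1 ≤ t * K := by
    refine (pi_norm_le_iff_of_nonneg (by positivity)).2 fun j => h1 j
  have hbad := hΘ x.1 hk
  have hφ : φ K ≤ φ (intSupNorm x.1) := hφmono _ _ hnorm1 (by nlinarith)
  have hub : intSupNorm x.1 ^ n * ∏ i, distNearestInt (linForm Θ x.1 i) ≤
      t ^ (n + M) * (K ^ n * ∏ i, r i) := by
    have ha : intSupNorm x.1 ^ n ≤ (t * K) ^ n := pow_le_pow_left₀ (by linarith) hnorm _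
    have hb : ∏ i, distNearestInt (linForm Θ x.1 i) ≤ ∏ i, (t * r i) :=
      Finset.prod_le_prod (fun i _ => distNearestInt_nonneg _)
        fun i _ => (distNearestInt_le_abs_sub _ _).trans (h2 i)
    refine (mul_le_mul ha hb (Finset.prod_nonneg fun i _ => distNearestInt_nonneg _)
      (by positivity)).trans_eq ?_
    rw [Finset.prod_mul_distrib, Finset.prod_const, Finset.card_univ, Fintype.card_fin]
    ring
  have hpos : 0 < K ^ n * ∏ i, r i := mul_pos (by positivity) (Finset.prod_pos fun i _ => hr i)
  have hstrict : t ^ (n + M) * (K ^ n * ∏ i, r i) < ℓ ^ (n + M) * (K ^ n * ∏ i, r i) :=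
    mul_lt_mul_of_pos_right (pow_lt_pow_left₀ hlt ht0 (by omega)) hpos
  linarith

/-- Number of integer vectors of norm at most `K` on which the linear forms are simultaneously
within `r` of an integer. -/
theorem card_simultaneously_small_le {M n : ℕ} (hn : 1 ≤ n) {φ : ℝ → ℝ}
    (hφpos : ∀ x, 1 ≤ x → 0 < φ x) (hφmono : ∀ x y, 1 ≤ x → x ≤ y → φ y ≤ φ x)
    {Θ : Matrix (Fin M) (Fin n) ℝ} (hΘ : SemiMultBad φ Θ) {K : ℝ} (hK : 1 ≤ K) {r : Fin M → ℝ}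
    (hr : ∀ i, 0 < r i) (hr2 : ∀ i, r i ≤ 1 / 2) (S : Finset (Fin n → ℤ))
    (hS : ∀ k ∈ S, intSupNorm k ≤ K ∧ ∀ i, distNearestInt (linForm Θ k i) ≤ r i)
    (hT : φ K ≤ K ^ n * ∏ i, r i) :
    (S.card : ℝ) ≤ (5 * ((n : ℝ) + M + 1)) ^ (n + M) * (K ^ n * ∏ i, r i +
      (K ^ n * (∏ i, r i) / φ K) ^ (1 - 1 / ((n : ℝ) + M))) := by
  classical
  have hK0 : 0 < K := by linarith
  have hrpos : 0 < ∏ i, r i := Finset.prod_pos fun i _ => hr i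
  have hφK := hφpos K hK
  set V := K ^ n * ∏ i, r i with hV
  have hVpos : 0 < V := by positivity
  set T := V / φ K with hTdef
  have hT1 : 1 ≤ T := (one_le_div hφK).2 hT
  have hT0 : 0 < T := by linarith
  have hDpos : (0 : ℝ) < (n : ℝ) + M := by
    have : (1 : ℝ) ≤ n := by exact_mod_cast hn
    positivity
  have hD1 : (1 : ℝ) ≤ (n : ℝ) + M := by
    have h1 : (1 : ℝ) ≤ n := by exact_mod_cast hn
    have h2 : (0 : ℝ) ≤ M := by positivity
    linarith
  set Λ := (scaledLatticeHom Θ K r).range with hΛ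
  have : Countable Λ := by
    rw [hΛ]
    exact (Set.countable_range (scaledLatticeHom Θ K r)).to_subtype
  let g : (Fin n → ℤ) → (Fin n ⊕ Fin M → ℝ) := fun k =>
    scaledLatticeHom Θ K r (k, fun i => round (linForm Θ k i))
  have hg : Function.Injective g := by
    intro k l hkl
    ext j
    have := congrFun hkl (Sum.inl j)
    simp only [g, scaledLatticeHom, AddMonoidHom.coe_mk, ZeroHom.coe_mk, Sum.elim_inl] at this
    rw [div_left_inj' hK0.ne'] at this
    exact_mod_cast this
  have hcardS : (S.image g).card = S.card := Finset.card_image_of_injective _ hg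
  have hS' : ∀ s ∈ S.image g, s ∈ Λ ∧ ‖s‖ ≤ 1 := by
    intro s hs
    obtain ⟨k, hk, rfl⟩ := Finset.mem_image.1 hs
    refine ⟨⟨_, rfl⟩, (pi_norm_le_iff_of_nonneg zero_le_one).2 ?_⟩
    rintro (j | i)
    · simp only [g, scaledLatticeHom, AddMonoidHom.coe_mk, ZeroHom.coe_mk, Sum.elim_inl,
        Real.norm_eq_abs, abs_div, abs_of_pos hK0]
      rw [div_le_one hK0]
      exact (norm_le_pi_norm (fun j => (k j : ℝ)) j).trans (hS k hk).1
    · simp only [g, scaledLatticeHom, AddMonoidHom.coe_mk, ZeroHom.coe_mk, Sum.elim_inr,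
        Real.norm_eq_abs, abs_div, abs_of_pos (hr i)]
      rw [div_le_one (hr i)]
      exact (hS k hk).2 i
  have hTpow : 0 < T ^ (1 - 1 / ((n : ℝ) + M)) := Real.rpow_pos_of_pos hT0 _
  have hcD : Fintype.card (Fin n ⊕ Fin M) = n + M := by simp
  by_cases hspan : Submodule.span ℝ ((Λ : Set (Fin n ⊕ Fin M → ℝ)) ∩ Metric.closedBall 0 1) = ⊤
  · set F : Set (Fin n ⊕ Fin M → ℝ) :=
      Set.univ.pi fun i => Set.Ico 0 (Sum.elim (fun _ => 1 / K) (fun i => 1 / r i) i) with hF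
    have hFm : MeasurableSet F := MeasurableSet.univ_pi fun i => measurableSet_Ico
    have hvol : volume F = ENNReal.ofReal (1 / V) := by
      rw [hF, Real.volume_pi_Ico]
      rw [← ENNReal.ofReal_prod_of_nonneg]
      · congr 1
        simp [hV, Fintype.prod_sum_type]
        ring
      · rintro (j | i) -
        · simp [hK0.le]
        · simp [(hr i).le]
    have hdisj : ∀ x ∈ F, ∀ y ∈ F, x - y ∈ Λ → x = y := by
      intro x hx y hy hxy
      obtain ⟨⟨k, p⟩, hkp⟩ := hxy
      have hk : k = 0 := by
        ext j
        have h1 := congrFun hkp (Sum.inl j)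
        have h2 := hx (Sum.inl j) trivial
        have h3 := hy (Sum.inl j) trivial
        simp only [scaledLatticeHom, AddMonoidHom.coe_mk, ZeroHom.coe_mk, Sum.elim_inl,
          Pi.sub_apply, Set.mem_Ico] at h1 h2 h3
        have h4 : |(k j : ℝ) / K| < 1 / K := by
          rw [h1, abs_lt]; constructor <;> linarith
        rw [abs_div, abs_of_pos hK0, div_lt_div_iff_of_pos_right hK0] at h4
        have h5 : |k j| < 1 := by exact_mod_cast h4
        simpa using Int.abs_lt_one_iff.1 h5
      have hp : p = 0 := by
        ext i
        have h1 := congrFun hkp (Sum.inr i)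
        have h2 := hx (Sum.inr i) trivial
        have h3 := hy (Sum.inr i) trivial
        simp only [scaledLatticeHom, AddMonoidHom.coe_mk, ZeroHom.coe_mk, Sum.elim_inr,
          Pi.sub_apply, Set.mem_Ico, hk, linForm_zero, zero_sub] at h1 h2 h3
        have h4 : |-(p i : ℝ) / r i| < 1 / r i := by
          rw [h1, abs_lt]; constructor <;> linarith
        rw [abs_div, abs_neg, abs_of_pos (hr i), div_lt_div_iff_of_pos_right (hr i)] at h4
        have h5 : |p i| < 1 := by exact_mod_cast h4
        simpa using Int.abs_lt_one_iff.1 h5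
      rw [hk, hp, show ((0 : Fin n → ℤ), (0 : Fin M → ℤ)) = 0 from rfl, map_zero] at hkp
      exact sub_eq_zero.1 hkp.symm
    have h := card_mul_volume_le_of_span_eq_top Λ hFm hdisj hspan (S.image g) hS'
    rw [hcardS, hvol, hcD, ← ENNReal.ofReal_natCast, ← ENNReal.ofReal_mul (by positivity),
      ENNReal.ofReal_le_ofReal_iff (by positivity), mul_one_div, div_le_iff₀ hVpos] at h
    refine h.trans ?_
    refine mul_le_mul (pow_le_pow_left₀ (by positivity) ?_ _) (by linarith) hVpos.le (by positivity)
    push_cast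
    nlinarith
  · set ℓ := T ^ (-(1 / ((n : ℝ) + M))) with hℓ
    have hℓ0 : 0 < ℓ := Real.rpow_pos_of_pos hT0 _
    have hℓ1 : ℓ ≤ 1 := Real.rpow_le_one_of_one_le_of_nonpos hT1 (by
      have : 0 ≤ 1 / ((n : ℝ) + M) := by positivity
      linarith)
    have hℓD : ℓ ^ (n + M) = T⁻¹ := by
      rw [hℓ, ← Real.rpow_natCast, ← Real.rpow_mul hT0.le]
      push_cast
      rw [neg_mul, one_div_mul_cancel hDpos.ne', Real.rpow_neg_one]
    have hmin : ∀ v ∈ Λ, v ≠ 0 → ℓ ≤ ‖v‖ := by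
      rintro _ ⟨x, rfl⟩ hx
      refine le_norm_scaledLatticeHom hn hφmono hΘ hK hr hr2 hℓ0 hℓ1 ?_ x hx
      rw [hℓD, ← hV, hTdef, inv_div, div_mul_cancel₀ _ hVpos.ne']
    have h := card_le_of_span_ne_top Λ hspan hℓ0 hℓ1 hmin (S.image g) hS'
    rw [hcardS, hcD, div_pow] at h
    refine h.trans ?_
    have h1 : (5 * ((n + M : ℕ) : ℝ)) ^ (n + M - 1) ≤ (5 * ((n : ℝ) + M + 1)) ^ (n + M) := by
      push_cast
      refine (pow_le_pow_left₀ (by positivity) (by linarith) _).trans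
        (pow_le_pow_right₀ (by linarith) (Nat.sub_le _ _))
    have h2 : (ℓ ^ (n + M - 1))⁻¹ = T ^ (1 - 1 / ((n : ℝ) + M)) := by
      rw [hℓ, ← Real.rpow_natCast, ← Real.rpow_mul hT0.le, ← Real.rpow_neg hT0.le]
      congr 1
      rw [Nat.cast_sub (by omega)]
      push_cast
      field_simp
    rw [div_eq_mul_inv, h2]
    refine mul_le_mul h1 (by linarith) hTpow.le (by positivity)

theorem sum_pow_sub_sum_le {d P : ℕ} {ρ : ℝ} (hρ0 : 0 ≤ ρ) (hρ1 : ρ < 1)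
    (I : Finset (Fin (d + 1) → ℕ)) (hI : ∀ t ∈ I, ∑ i, t i ≤ P) :
    ∑ t ∈ I, ρ ^ (P - ∑ i, t i) ≤ ((P : ℝ) + 1) ^ d * (1 - ρ)⁻¹ := by
  classical
  let g : (Fin (d + 1) → ℕ) → ℕ × (Fin d → ℕ) := fun t => (P - ∑ i, t i, Fin.tail t)
  have hg : Set.InjOn g I := by
    intro t ht u hu htu
    have h1 : P - ∑ i, t i = P - ∑ i, u i := congrArg Prod.fst htu
    have h2 : Fin.tail t = Fin.tail u := congrArg Prod.snd htu
    have h3 := hI t ht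
    have h4 := hI u hu
    have h5 : ∑ i, t i = ∑ i, u i := by omega
    rw [Fin.sum_univ_succ, Fin.sum_univ_succ] at h5
    have h6 : ∑ i : Fin d, t i.succ = ∑ i : Fin d, u i.succ :=
      Finset.sum_congr rfl fun i _ => congrFun h2 i
    rw [← Fin.cons_self_tail t, ← Fin.cons_self_tail u, h2]
    congr 1
    omega
  have hsub : I.image g ⊆ Finset.range (P + 1) ×ˢ
      Fintype.piFinset fun _ : Fin d => Finset.range (P + 1) := by
    intro x hx
    obtain ⟨t, ht, rfl⟩ := Finset.mem_image.1 hx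
    simp only [g, Finset.mem_product, Finset.mem_range, Fintype.mem_piFinset]
    refine ⟨by omega, fun i => ?_⟩
    have := Finset.single_le_sum (f := t) (fun i _ => Nat.zero_le _) (Finset.mem_univ i.succ)
    have := hI t ht
    simp only [Fin.tail]
    omega
  calc ∑ t ∈ I, ρ ^ (P - ∑ i, t i) = ∑ x ∈ I.image g, ρ ^ x.1 := by
        rw [Finset.sum_image hg]
    _ ≤ ∑ x ∈ Finset.range (P + 1) ×ˢ Fintype.piFinset fun _ : Fin d => Finset.range (P + 1),
          ρ ^ x.1 := Finset.sum_le_sum_of_subset_of_nonneg hsub fun _ _ _ => by positivity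
    _ = (P + 1) ^ d * ∑ j ∈ Finset.range (P + 1), ρ ^ j := by
        rw [Finset.sum_product, Finset.mul_sum]
        refine Finset.sum_congr rfl fun j _ => ?_
        simp
    _ ≤ _ := by
        refine mul_le_mul_of_nonneg_left ?_ (by positivity)
        exact (summable_geometric_of_lt_one hρ0 hρ1).sum_le_tsum _ (fun _ _ => by positivity)
          |>.trans_eq (tsum_geometric_of_lt_one hρ0 hρ1)

theorem distNearestInt_pos_of_semiMultBad {M n : ℕ} {φ : ℝ → ℝ} (hφpos : ∀ x, 1 ≤ x → 0 < φ x)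
    {Θ : Matrix (Fin M) (Fin n) ℝ} (hΘ : SemiMultBad φ Θ) {k : Fin n → ℤ} (hk : k ≠ 0)
    (i : Fin M) : 0 < distNearestInt (linForm Θ k i) := by
  refine (distNearestInt_nonneg _).lt_of_ne fun h => ?_
  have h1 := hΘ k hk
  rw [Finset.prod_eq_zero (Finset.mem_univ i) h.symm, mul_zero] at h1
  exact absurd (hφpos _ (one_le_intSupNorm hk)) (not_lt.2 h1)

theorem exists_dyadic_exponent {x : ℝ} (hx0 : 0 < x) (hx : x ≤ 1 / 2) :
    ∃ t : ℕ, 1 ≤ t ∧ x ≤ (1 / 2) ^ t ∧ x⁻¹ ≤ 2 * 2 ^ t := by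
  obtain ⟨t, h1, h2⟩ := exists_nat_pow_near_of_lt_one hx0 (hx.trans (by norm_num))
    (show (0 : ℝ) < 1 / 2 by norm_num) (by norm_num)
  refine ⟨t, ?_, h2, ?_⟩
  · by_contra! h
    interval_cases t
    norm_num at h1 hx
    linarith
  · rw [inv_le_comm₀ hx0 (by positivity)]
    refine le_trans (le_of_eq ?_) h1.le
    rw [one_div, inv_pow, pow_succ, mul_comm]

/-- Sums of reciprocals of products of distances to the nearest integer. -/
theorem exists_sum_prod_inv_dist_le (d : ℕ) {n : ℕ} (hn : 1 ≤ n) :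
    ∃ C : ℝ, 0 < C ∧ ∀ φ : ℝ → ℝ, (∀ x, 1 ≤ x → 0 < φ x ∧ φ x ≤ 1) →
      (∀ x y, 1 ≤ x → x ≤ y → φ y ≤ φ x) →
      ∀ Θ : Matrix (Fin (d + 1)) (Fin n) ℝ, SemiMultBad φ Θ → ∀ K : ℝ, 1 ≤ K →
      ∀ S : Finset (Fin n → ℤ), (∀ k ∈ S, k ≠ 0 ∧ intSupNorm k ≤ K) →
      ∑ k ∈ S, ∏ i, (distNearestInt (linForm Θ k i))⁻¹ ≤
        C * (K ^ n * (Real.logb 2 (K ^ n / φ K) + 1) ^ (d + 1) +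
          K ^ n / φ K * (Real.logb 2 (K ^ n / φ K) + 1) ^ d) := by
  classical
  set D : ℝ := (n : ℝ) + (d + 1 : ℕ) with hD
  have hDpos : 0 < D := by rw [hD]; positivity
  set ρ : ℝ := 2 ^ (-(1 / D)) with hρ
  have hρ0 : 0 < ρ := by positivity
  have hρ1 : ρ < 1 := Real.rpow_lt_one_of_one_lt_of_neg one_lt_two
    (by have : 0 < 1 / D := by positivity
        linarith)
  set CD : ℝ := (5 * (D + 1)) ^ (n + (d + 1)) with hCD
  have hCDpos : 0 < CD := by positivity
  have hρinv : 1 ≤ (1 - ρ)⁻¹ := (one_le_inv₀ (by linarith)).2 (by linarith)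
  refine ⟨2 ^ (d + 1) * CD * (1 - ρ)⁻¹, by positivity, ?_⟩
  intro φ hφ hφmono Θ hΘ K hK S hS
  have hφpos : ∀ x, 1 ≤ x → 0 < φ x := fun x hx => (hφ x hx).1
  have hK0 : 0 < K := by linarith
  have hφK := hφpos K hK
  set X := K ^ n / φ K with hX
  have hX1 : 1 ≤ X := (one_le_div hφK).2 ((hφ K hK).2.trans (one_le_pow₀ hK))
  have hX0 : 0 < X := by linarith
  have hlog0 : 0 ≤ Real.logb 2 X := Real.logb_nonneg one_lt_two hX1
  set P := ⌊Real.logb 2 X⌋₊ with hP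
  have hPle : (P : ℝ) ≤ Real.logb 2 X := Nat.floor_le hlog0
  have hPX : (2 : ℝ) ^ P ≤ X := by
    rwa [← Real.rpow_natCast, ← Real.le_logb_iff_rpow_le one_lt_two hX0]
  have hex : ∀ k : Fin n → ℤ, ∃ t : Fin (d + 1) → ℕ, k ≠ 0 → ∀ i, 1 ≤ t i ∧
      distNearestInt (linForm Θ k i) ≤ (1 / 2) ^ t i ∧
      (distNearestInt (linForm Θ k i))⁻¹ ≤ 2 * 2 ^ t i := by
    intro k
    by_cases hk : k = 0
    · exact ⟨0, fun h => absurd hk h⟩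
    · choose t ht using fun i => exists_dyadic_exponent
        (distNearestInt_pos_of_semiMultBad hφpos hΘ hk i) (distNearestInt_le_half _)
      exact ⟨t, fun _ => ht⟩
  choose τ hτ using hex
  have hprodhalf : ∀ t : Fin (d + 1) → ℕ, ∏ i, (1 / 2 : ℝ) ^ t i = (2 ^ ∑ i, t i)⁻¹ := by
    intro t
    rw [Finset.prod_pow_eq_pow_sum, one_div, inv_pow]
  have hφle : ∀ k ∈ S, φ K ≤ K ^ n * ∏ i, (1 / 2 : ℝ) ^ τ k i := by
    intro k hk
    obtain ⟨hk0, hkK⟩ := hS k hk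
    have h1 := one_le_intSupNorm hk0
    refine (hφmono _ _ h1 hkK).trans ((hΘ k hk0).trans ?_)
    refine mul_le_mul (pow_le_pow_left₀ (by linarith) hkK _) ?_
      (Finset.prod_nonneg fun i _ => distNearestInt_nonneg _) (by positivity)
    exact Finset.prod_le_prod (fun i _ => distNearestInt_nonneg _) fun i _ => (hτ k hk0 i).2.1
  set I := S.image τ with hI
  have hsX : ∀ t ∈ I, (2 : ℝ) ^ ∑ i, t i ≤ X := by
    intro t ht
    obtain ⟨k, hk, rfl⟩ := Finset.mem_image.1 ht
    have := hφle k hk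
    rw [hprodhalf, ← div_eq_mul_inv, le_div_iff₀ (by positivity)] at this
    rw [hX, le_div_iff₀ hφK]
    linarith
  have hsP : ∀ t ∈ I, ∑ i, t i ≤ P := by
    intro t ht
    rw [hP, Nat.le_floor_iff hlog0, Real.le_logb_iff_rpow_le one_lt_two hX0, Real.rpow_natCast]
    exact hsX t ht
  have hfiber : ∀ t ∈ I, ∑ k ∈ S with τ k = t, ∏ i, (distNearestInt (linForm Θ k i))⁻¹ ≤
      2 ^ (d + 1) * CD * (K ^ n + X * ρ ^ (P - ∑ i, t i)) := by
    intro t ht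
    set s := ∑ i, t i with hs
    have hterm : ∀ k ∈ S.filter (fun k => τ k = t),
        ∏ i, (distNearestInt (linForm Θ k i))⁻¹ ≤ 2 ^ (d + 1) * 2 ^ s := by
      intro k hk
      obtain ⟨hkS, rfl⟩ := Finset.mem_filter.1 hk
      refine (Finset.prod_le_prod (fun i _ => inv_nonneg.2 (distNearestInt_nonneg _))
        fun i _ => (hτ k (hS k hkS).1 i).2.2).trans_eq ?_
      rw [Finset.prod_mul_distrib, Finset.prod_pow_eq_pow_sum]
      simp [hs]
    have hcard : ((S.filter (fun k => τ k = t)).card : ℝ) ≤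
        CD * (K ^ n * (2 ^ s)⁻¹ + (K ^ n * (2 ^ s)⁻¹ / φ K) ^ (1 - 1 / D)) := by
      obtain ⟨k₀, hk₀, hk₀t⟩ := Finset.mem_image.1 ht
      have h := card_simultaneously_small_le hn hφpos hφmono hΘ hK
        (r := fun i => (1 / 2 : ℝ) ^ t i) (fun i => by positivity) ?_
        (S.filter (fun k => τ k = t)) ?_ ?_
      · rw [hprodhalf] at h
        exact h
      · intro i
        rw [← hk₀t]
        have := (hτ k₀ (hS k₀ hk₀).1 i).1
        calc (1 / 2 : ℝ) ^ τ k₀ i ≤ (1 / 2) ^ 1 :=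
              pow_le_pow_of_le_one (by norm_num) (by norm_num) this
          _ = 1 / 2 := pow_one _
      · intro k hk
        obtain ⟨hkS, rfl⟩ := Finset.mem_filter.1 hk
        exact ⟨(hS k hkS).2, fun i => (hτ k (hS k hkS).1 i).2.1⟩
      · rw [← hk₀t]
        exact hφle k₀ hk₀
    set T := K ^ n * (2 ^ s)⁻¹ / φ K with hT
    have hTX : T = X / 2 ^ s := by
      rw [hT, hX]; field_simp
    have hT0 : 0 < T := by rw [hTX]; positivity
    have hTge : (2 : ℝ) ^ (P - s) ≤ T := by
      rw [hTX, le_div_iff₀ (by positivity), ← pow_add, Nat.sub_add_cancel (hsP t ht)]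
      exact hPX
    have hTρ : T ^ (-(1 / D)) ≤ ρ ^ (P - s) := by
      refine (Real.rpow_le_rpow_of_nonpos (by positivity) hTge ?_).trans_eq ?_
      · have : 0 < 1 / D := by positivity
        linarith
      · rw [hρ, ← Real.rpow_natCast, ← Real.rpow_natCast, ← Real.rpow_mul zero_le_two,
          ← Real.rpow_mul zero_le_two, mul_comm]
    calc _ ≤ ((S.filter (fun k => τ k = t)).card : ℝ) * (2 ^ (d + 1) * 2 ^ s) := by
          refine (Finset.sum_le_card_nsmul _ _ _ hterm).trans_eq ?_
          rw [nsmul_eq_mul]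
      _ ≤ CD * (K ^ n * (2 ^ s)⁻¹ + T ^ (1 - 1 / D)) * (2 ^ (d + 1) * 2 ^ s) := by gcongr
      _ = 2 ^ (d + 1) * CD * (K ^ n + X * T ^ (-(1 / D))) := by
          rw [sub_eq_add_neg, Real.rpow_add hT0, Real.rpow_one]
          nth_rewrite 1 [hTX]
          field_simp
      _ ≤ _ := by gcongr
  have hIcard : (I.card : ℝ) ≤ ((P : ℝ) + 1) ^ (d + 1) := by
    have hsub : I ⊆ Fintype.piFinset fun _ : Fin (d + 1) => Finset.range (P + 1) := by
      intro t ht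
      simp only [Fintype.mem_piFinset, Finset.mem_range]
      intro i
      have h1 := Finset.single_le_sum (f := t) (fun i _ => Nat.zero_le _) (Finset.mem_univ i)
      have h2 := hsP t ht
      omega
    have := Finset.card_le_card hsub
    rw [Fintype.card_piFinset] at this
    simp only [Finset.card_range, Finset.prod_const, Finset.card_univ, Fintype.card_fin] at this
    exact_mod_cast this
  calc ∑ k ∈ S, ∏ i, (distNearestInt (linForm Θ k i))⁻¹
      = ∑ t ∈ I, ∑ k ∈ S with τ k = t, ∏ i, (distNearestInt (linForm Θ k i))⁻¹ :=
        (Finset.sum_fiberwise_of_maps_to (fun k hk => Finset.mem_image_of_mem _ hk) _).symm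
    _ ≤ ∑ t ∈ I, 2 ^ (d + 1) * CD * (K ^ n + X * ρ ^ (P - ∑ i, t i)) := Finset.sum_le_sum hfiber
    _ = 2 ^ (d + 1) * CD * (K ^ n * I.card + X * ∑ t ∈ I, ρ ^ (P - ∑ i, t i)) := by
        rw [← Finset.mul_sum, Finset.sum_add_distrib, ← Finset.mul_sum, Finset.sum_const,
          nsmul_eq_mul, mul_comm (K ^ n)]
    _ ≤ 2 ^ (d + 1) * CD * (K ^ n * (((P : ℝ) + 1) ^ (d + 1) * (1 - ρ)⁻¹) +
          X * (((P : ℝ) + 1) ^ d * (1 - ρ)⁻¹)) := by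
        gcongr
        · exact hIcard.trans (le_mul_of_one_le_right (by positivity) hρinv)
        · exact sum_pow_sub_sum_le hρ0.le hρ1 I hsP
    _ = 2 ^ (d + 1) * CD * (1 - ρ)⁻¹ * (K ^ n * ((P : ℝ) + 1) ^ (d + 1) +
          X * ((P : ℝ) + 1) ^ d) := by ring
    _ ≤ _ := by
        have : 0 ≤ (1 - ρ)⁻¹ := by linarith
        gcongr

theorem summable_succ_pow_mul_half_pow (m : ℕ) :
    Summable fun l : ℕ => ((l : ℝ) + 1) ^ m * (1 / 2) ^ l := by
  have h₀ : Summable fun l : ℕ => (l : ℝ) ^ m * (1 / 2) ^ l :=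
    summable_pow_mul_geometric_of_norm_lt_one m (by norm_num)
  have h := (summable_nat_add_iff 1).2 h₀
  refine (h.mul_left 2).congr fun l => ?_
  push_cast
  rw [pow_succ (1 / 2 : ℝ) l]
  ring

theorem exists_shell_bound {d n : ℕ} (hn : 1 ≤ n) {φ : ℝ → ℝ}
    (hφ : ∀ x, 1 ≤ x → 0 < φ x ∧ φ x ≤ 1) (hφmono : ∀ x y, 1 ≤ x → x ≤ y → φ y ≤ φ x)
    {c : ℝ} (hc0 : 0 < c) (hc : ∀ x, 1 ≤ x → c * φ x ≤ φ (2 * x)) :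
    ∃ C : ℝ, 0 < C ∧ ∀ Θ : Matrix (Fin (d + 1)) (Fin n) ℝ, SemiMultBad φ Θ →
      ∀ δ : ℝ, 0 < δ → δ < 1 / 2 → ∀ l : ℕ,
      ∀ S : Finset (Fin n → ℤ), (∀ k ∈ S, k ≠ 0 ∧ intSupNorm k ≤ 2 ^ (l + 1) * (1 / δ)) →
      ∑ k ∈ S, ∏ i, (distNearestInt (linForm Θ k i))⁻¹ ≤
        C * (((l : ℝ) + 1) ^ (d + 1) * (2 ^ n / c) ^ l) * ((1 / δ ^ n) *
          (Real.log ((1 / δ ^ n) / φ (1 / δ)) ^ (d + 1) +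
            (1 / φ (1 / δ)) * Real.log ((1 / δ ^ n) / φ (1 / δ)) ^ d)) := by
  obtain ⟨C, hC, hsum⟩ := exists_sum_prod_inv_dist_le d hn
  have hc1 : c ≤ 1 := by
    have h1 := hc 1 le_rfl
    have h2 := hφmono 1 (2 * 1) le_rfl (by norm_num)
    have h3 := (hφ 1 le_rfl).1
    exact le_of_mul_le_mul_right (by linarith) h3
  set G : ℝ := 2 ^ n / c with hG
  have hG2n : (2 : ℝ) ^ n ≤ G := (le_div_iff₀ hc0).2 (mul_le_of_le_one_right (by positivity) hc1)
  have hG1 : 1 ≤ G := (one_le_pow₀ one_le_two).trans hG2n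
  have hG0 : 0 < G := by linarith
  have hlog2 : 0 < Real.log 2 := Real.log_pos one_lt_two
  have hlog21 : Real.log 2 ≤ 1 := Real.log_two_lt_d9.le.trans (by norm_num)
  set A : ℝ := (Real.logb 2 G + 2) / Real.log 2 with hA
  have hlogG : 0 ≤ Real.logb 2 G := Real.logb_nonneg one_lt_two hG1
  have hA1 : 1 ≤ A := (one_le_div hlog2).2 (by linarith)
  refine ⟨C * G * A ^ (d + 1), by positivity, ?_⟩
  intro Θ hΘ δ hδ0 hδ l S hS
  have hδinv : 2 ≤ 1 / δ := by rw [le_div_iff₀ hδ0]; linarith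
  have hpow1 : (1 : ℝ) ≤ 2 ^ (l + 1) := one_le_pow₀ one_le_two
  have hK : 1 ≤ 2 ^ (l + 1) * (1 / δ) := by nlinarith
  have h := hsum φ hφ hφmono Θ hΘ _ hK S hS
  set K := 2 ^ (l + 1) * (1 / δ) with hKdef
  have hφK := (hφ K hK).1
  have hφδ := hφ (1 / δ) (by linarith)
  set X := (1 / δ ^ n) / φ (1 / δ) with hX
  set L := Real.log X with hL
  have hδn : (2 : ℝ) ≤ 1 / δ ^ n := by
    rw [← one_div_pow]
    calc (2 : ℝ) ≤ 1 / δ := hδinv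
      _ = (1 / δ) ^ 1 := (pow_one _).symm
      _ ≤ (1 / δ) ^ n := pow_le_pow_right₀ (by linarith) hn
  have hX2 : 2 ≤ X := by
    rw [hX, le_div_iff₀ hφδ.1]; nlinarith [hφδ.2]
  have hLge : Real.log 2 ≤ L := Real.log_le_log two_pos hX2
  have hL0 : 0 < L := by linarith
  have hφiter : ∀ m : ℕ, c ^ m * φ (1 / δ) ≤ φ (2 ^ m * (1 / δ)) := by
    intro m
    induction m with
    | zero => simp
    | succ m ih =>
      have h1 : 1 ≤ 2 ^ m * (1 / δ) := by
        have : (1 : ℝ) ≤ 2 ^ m := one_le_pow₀ one_le_two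
        nlinarith
      calc c ^ (m + 1) * φ (1 / δ) = c * (c ^ m * φ (1 / δ)) := by ring
        _ ≤ c * φ (2 ^ m * (1 / δ)) := by gcongr
        _ ≤ φ (2 * (2 ^ m * (1 / δ))) := hc _ h1
        _ = _ := by congr 1; ring
  have hKn : K ^ n = (2 ^ n) ^ (l + 1) * (1 / δ ^ n) := by
    rw [hKdef, mul_pow, ← pow_mul, ← pow_mul, one_div_pow, mul_comm n]
  have hKn' : K ^ n ≤ G ^ (l + 1) * (1 / δ ^ n) := by
    rw [hKn]; gcongr
  have hXl : K ^ n / φ K ≤ G ^ (l + 1) * X := by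
    rw [hKn, hX, hG, div_pow]
    calc (2 ^ n) ^ (l + 1) * (1 / δ ^ n) / φ K
        ≤ (2 ^ n) ^ (l + 1) * (1 / δ ^ n) / (c ^ (l + 1) * φ (1 / δ)) := by
          have := mul_pos (pow_pos hc0 (l + 1)) hφδ.1
          gcongr
          exact hφiter _
      _ = _ := by field_simp
  have hXl1 : 1 ≤ K ^ n / φ K := (one_le_div hφK).2 ((hφ K hK).2.trans (one_le_pow₀ hK))
  have hlogb : Real.logb 2 (K ^ n / φ K) + 1 ≤ ((l : ℝ) + 1) * A * L := by
    have h1 : Real.logb 2 (K ^ n / φ K) ≤ (l + 1) * Real.logb 2 G + L / Real.log 2 := by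
      refine (Real.logb_le_logb_of_le one_lt_two (by linarith) hXl).trans_eq ?_
      rw [Real.logb_mul (by positivity) (by positivity), Real.logb_pow]
      push_cast
      rfl
    have h2 : 1 ≤ L / Real.log 2 := (one_le_div hlog2).2 hLge
    have h3 : ((l : ℝ) + 1) * A * L = (l + 1) * (Real.logb 2 G + 2) * (L / Real.log 2) := by
      rw [hA]; ring
    rw [h3]
    have h4 : (0 : ℝ) ≤ l := Nat.cast_nonneg _
    have h5 : (l + 1) * Real.logb 2 G ≤ (l + 1) * Real.logb 2 G * (L / Real.log 2) :=
      le_mul_of_one_le_right (by positivity) h2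
    nlinarith
  have hlb0 : 0 ≤ Real.logb 2 (K ^ n / φ K) + 1 := by
    have := Real.logb_nonneg one_lt_two hXl1
    linarith
  have hl1 : (1 : ℝ) ≤ (l : ℝ) + 1 := by
    have : (0 : ℝ) ≤ l := Nat.cast_nonneg _
    linarith
  refine h.trans ?_
  have hlA : 1 ≤ ((l : ℝ) + 1) * A := one_le_mul_of_one_le_of_one_le hl1 hA1
  calc C * (K ^ n * (Real.logb 2 (K ^ n / φ K) + 1) ^ (d + 1) +
          K ^ n / φ K * (Real.logb 2 (K ^ n / φ K) + 1) ^ d)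
      ≤ C * (G ^ (l + 1) * (1 / δ ^ n) * (((l : ℝ) + 1) * A * L) ^ (d + 1) +
          G ^ (l + 1) * X * (((l : ℝ) + 1) * A * L) ^ d) := by gcongr
    _ = C * (G ^ (l + 1) * (1 / δ ^ n)) * ((((l : ℝ) + 1) * A) ^ (d + 1) * L ^ (d + 1) +
          (((l : ℝ) + 1) * A) ^ d * ((1 / φ (1 / δ)) * L ^ d)) := by
        rw [hX, mul_pow _ L, mul_pow _ L]
        ring
    _ ≤ C * (G ^ (l + 1) * (1 / δ ^ n)) * ((((l : ℝ) + 1) * A) ^ (d + 1) * L ^ (d + 1) +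
          (((l : ℝ) + 1) * A) ^ (d + 1) * ((1 / φ (1 / δ)) * L ^ d)) := by
        have h6 : (0 : ℝ) ≤ (1 / φ (1 / δ)) * L ^ d :=
          mul_nonneg (one_div_nonneg.2 hφδ.1.le) (by positivity)
        gcongr
        omega
    _ = _ := by
        rw [mul_pow _ A, pow_succ G l]
        ring

/-- Weighted sums of reciprocals of products of distances, with polynomially decaying weights. -/
theorem exists_weighted_sum_le {d n : ℕ} (hn : 1 ≤ n) {φ : ℝ → ℝ}
    (hφ : ∀ x, 1 ≤ x → 0 < φ x ∧ φ x ≤ 1) (hφmono : ∀ x y, 1 ≤ x → x ≤ y → φ y ≤ φ x)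
    {c : ℝ} (hc0 : 0 < c) (hc : ∀ x, 1 ≤ x → c * φ x ≤ φ (2 * x)) :
    ∃ B : ℕ, ∃ C : ℝ, 0 < C ∧ ∀ Θ : Matrix (Fin (d + 1)) (Fin n) ℝ, SemiMultBad φ Θ →
      ∀ δ : ℝ, 0 < δ → δ < 1 / 2 → ∀ S : Finset (Fin n → ℤ), (∀ k ∈ S, k ≠ 0) →
      ∑ k ∈ S, ((1 + δ * intSupNorm k) ^ B)⁻¹ * ∏ i, (distNearestInt (linForm Θ k i))⁻¹ ≤
        C * ((1 / δ ^ n) * (Real.log ((1 / δ ^ n) / φ (1 / δ)) ^ (d + 1) +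
            (1 / φ (1 / δ)) * Real.log ((1 / δ ^ n) / φ (1 / δ)) ^ d)) := by
  classical
  obtain ⟨C, hC, hshell⟩ := exists_shell_bound (d := d) hn hφ hφmono hc0 hc
  set G : ℝ := 2 ^ n / c with hG
  have hG0 : 0 < G := by positivity
  obtain ⟨B, hB⟩ := pow_unbounded_of_one_lt (2 * G) (one_lt_two (α := ℝ))
  have hsumm := summable_succ_pow_mul_half_pow (d + 1)
  set Z := ∑' l : ℕ, ((l : ℝ) + 1) ^ (d + 1) * (1 / 2) ^ l with hZ
  have hZ0 : 0 ≤ Z := tsum_nonneg fun l => by positivity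
  refine ⟨B, C * (Z + 1), by positivity, ?_⟩
  intro Θ hΘ δ hδ0 hδ S hS
  set E := (1 / δ ^ n) * (Real.log ((1 / δ ^ n) / φ (1 / δ)) ^ (d + 1) +
            (1 / φ (1 / δ)) * Real.log ((1 / δ ^ n) / φ (1 / δ)) ^ d) with hE
  have hE0 : 0 ≤ E := by
    have h := hshell Θ hΘ δ hδ0 hδ 0 ∅ (by simp)
    simp only [Finset.sum_empty] at h
    exact nonneg_of_mul_nonneg_right h (by positivity)
  have hex : ∀ k : Fin n → ℤ, ∃ l : ℕ, (2 : ℝ) ^ l ≤ 1 + δ * intSupNorm k ∧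
      1 + δ * intSupNorm k < 2 ^ (l + 1) := by
    intro k
    refine exists_nat_pow_near ?_ one_lt_two
    have : 0 ≤ intSupNorm k := norm_nonneg _
    nlinarith
  choose shell hshell' using hex
  have hfiber : ∀ l ∈ S.image shell, ∑ k ∈ S with shell k = l, ((1 + δ * intSupNorm k) ^ B)⁻¹ *
      ∏ i, (distNearestInt (linForm Θ k i))⁻¹ ≤
        ((l : ℝ) + 1) ^ (d + 1) * (1 / 2) ^ l * (C * E) := by
    intro l _
    have hw : ∀ k ∈ S.filter (fun k => shell k = l), ((1 + δ * intSupNorm k) ^ B)⁻¹ *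
        ∏ i, (distNearestInt (linForm Θ k i))⁻¹ ≤
        ((2 ^ l) ^ B)⁻¹ * ∏ i, (distNearestInt (linForm Θ k i))⁻¹ := by
      intro k hk
      obtain ⟨-, rfl⟩ := Finset.mem_filter.1 hk
      refine mul_le_mul_of_nonneg_right ?_
        (Finset.prod_nonneg fun i _ => inv_nonneg.2 (distNearestInt_nonneg _))
      refine inv_anti₀ (by positivity) (pow_le_pow_left₀ (by positivity) (hshell' k).1 _)
    refine (Finset.sum_le_sum hw).trans ?_
    rw [← Finset.mul_sum]
    have h := hshell Θ hΘ δ hδ0 hδ l (S.filter (fun k => shell k = l)) ?_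
    · refine (mul_le_mul_of_nonneg_left h (by positivity)).trans ?_
      have hgeo : ((2 ^ l) ^ B)⁻¹ * G ^ l ≤ (1 / 2 : ℝ) ^ l := by
        rw [← pow_mul, mul_comm l B, pow_mul, ← inv_pow, ← mul_pow]
        refine pow_le_pow_left₀ (by positivity) ?_ _
        rw [inv_mul_le_iff₀ (by positivity)]
        linarith
      calc ((2 ^ l) ^ B)⁻¹ * (C * (((l : ℝ) + 1) ^ (d + 1) * G ^ l) * E)
          = ((l : ℝ) + 1) ^ (d + 1) * (((2 ^ l) ^ B)⁻¹ * G ^ l) * (C * E) := by ring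
        _ ≤ _ := by gcongr
    · intro k hk
      obtain ⟨hkS, rfl⟩ := Finset.mem_filter.1 hk
      refine ⟨hS k hkS, ?_⟩
      rw [mul_one_div, le_div_iff₀ hδ0]
      linarith [(hshell' k).2]
  calc _ = ∑ l ∈ S.image shell, ∑ k ∈ S with shell k = l, ((1 + δ * intSupNorm k) ^ B)⁻¹ *
        ∏ i, (distNearestInt (linForm Θ k i))⁻¹ :=
        (Finset.sum_fiberwise_of_maps_to (fun k hk => Finset.mem_image_of_mem _ hk) _).symm
    _ ≤ ∑ l ∈ S.image shell, ((l : ℝ) + 1) ^ (d + 1) * (1 / 2) ^ l * (C * E) :=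
        Finset.sum_le_sum hfiber
    _ ≤ Z * (C * E) := by
        rw [← Finset.sum_mul]
        refine mul_le_mul_of_nonneg_right ?_ (by positivity)
        exact hsumm.sum_le_tsum _ fun l _ => by positivity
    _ ≤ C * (Z + 1) * E := by nlinarith [mul_nonneg hC.le hE0]

end LatticePoints

section Fourier

open scoped SchwartzMap FourierTransform ContDiff

/-- A finite product of absolutely convergent series is the absolutely convergent series of
products. -/
theorem summable_norm_and_prod_tsum {n : ℕ} (f : Fin n → ℤ → ℂ)
    (hf : ∀ j, Summable fun m => ‖f j m‖) :
    (Summable fun k : Fin n → ℤ => ‖∏ j, f j (k j)‖) ∧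
      ∏ j, ∑' m, f j m = ∑' k : Fin n → ℤ, ∏ j, f j (k j) := by
  induction n with
  | zero => exact ⟨(hasSum_fintype _).summable, by simp⟩
  | succ n ih =>
    obtain ⟨hs, he⟩ := ih (fun j => f j.succ) (fun j => hf _)
    have key : ∀ p : ℤ × (Fin n → ℤ),
        ∏ j, f j ((Fin.consEquiv fun _ => ℤ) p j) = f 0 p.1 * ∏ j : Fin n, f j.succ (p.2 j) := by
      intro p
      simp [Fin.prod_univ_succ, Fin.consEquiv]
    constructor
    · rw [← (Fin.consEquiv fun _ : Fin (n + 1) => ℤ).summable_iff]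
      have := (hf 0).mul_norm hs
      refine this.congr fun p => ?_
      simp only [Function.comp_apply, key]
    · rw [← (Fin.consEquiv fun _ : Fin (n + 1) => ℤ).tsum_eq, Fin.prod_univ_succ, he,
        tsum_mul_tsum_of_summable_norm (hf 0) hs]
      exact tsum_congr fun p => (key p).symm

/-- The `ℤ`-periodic function obtained by summing the translates of `g (· / δ)`. -/
noncomputable def periodize (g : ℝ → ℝ) (δ x : ℝ) : ℝ := ∑' m : ℤ, g ((x + m) / δ)

theorem fourier_comp_div (f : ℝ → ℂ) {δ : ℝ} (hδ : 0 < δ) (ξ : ℝ) :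
    𝓕 (fun x => f (x / δ)) ξ = δ * 𝓕 f (δ * ξ) := by
  rw [Real.fourier_eq', Real.fourier_eq']
  have := MeasureTheory.Measure.integral_comp_div
    (fun v : ℝ => Complex.exp (↑(-2 * Real.pi * inner ℝ v (δ * ξ)) * Complex.I) • f v) δ
  rw [abs_of_pos hδ] at this
  rw [← Complex.real_smul, ← this]
  congr 1
  ext v
  congr 4
  simp only [RCLike.inner_apply, conj_trivial]
  field_simp

/-- Poisson summation: the Fourier expansion of a periodized bump function, with coefficients of
arbitrarily fast polynomial decay. -/
theorem exists_periodize_eq_tsum (g : ContDiffBump (0 : ℝ)) (B : ℕ) :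
    ∃ C : ℝ, 0 < C ∧ ∀ δ : ℝ, 0 < δ → ∃ a : ℤ → ℂ,
      a 0 = (δ * ∫ x, g x : ℝ) ∧
      (∀ m : ℤ, ‖a m‖ ≤ δ * C * ((1 + δ * |(m : ℝ)|) ^ B)⁻¹) ∧
      ∀ x : ℝ, ((periodize g δ x : ℝ) : ℂ) =
        ∑' m : ℤ, a m * Complex.exp (2 * Real.pi * Complex.I * (m * x)) := by
  have hcs : HasCompactSupport (fun x => ((g x : ℝ) : ℂ)) :=
    g.hasCompactSupport.comp_left Complex.ofReal_zero
  have hcd : ContDiff ℝ ∞ (fun x => ((g x : ℝ) : ℂ)) :=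
    Complex.ofRealCLM.contDiff.comp g.contDiff
  set G : 𝓢(ℝ, ℂ) := hcs.toSchwartzMap hcd
  have hGe : (G : ℝ → ℂ) = fun x => ((g x : ℝ) : ℂ) := rfl
  set K : ℝ := 2 ^ B * (Finset.Iic (B, 0)).sup (fun m => SchwartzMap.seminorm ℝ m.1 m.2) (𝓕 G)
  have hK : ∀ ξ : ℝ, (1 + |ξ|) ^ B * ‖𝓕 G ξ‖ ≤ K := by
    intro ξ
    have := SchwartzMap.one_add_le_sup_seminorm_apply (𝕜 := ℝ) (m := (B, 0)) (k := B) (n := 0)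
      le_rfl le_rfl (𝓕 G) ξ
    simpa using this
  refine ⟨|K| + 1, by positivity, fun δ hδ => ⟨fun m => δ * 𝓕 G (δ * m), ?_, ?_, ?_⟩⟩
  · simp only [Int.cast_zero, mul_zero]
    rw [SchwartzMap.fourier_coe, hGe, Real.fourier_eq']
    simp only [inner_zero_right, mul_zero, Complex.ofReal_zero, zero_mul, Complex.exp_zero,
      one_smul]
    rw [integral_complex_ofReal]
    push_cast
    rfl
  · intro m
    have h1 := hK (δ * m)
    rw [abs_mul, abs_of_pos hδ] at h1
    have h2 : 0 < (1 + δ * |(m : ℝ)|) ^ B := by positivity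
    rw [norm_mul, Complex.norm_real, Real.norm_of_nonneg hδ.le, mul_assoc]
    refine mul_le_mul_of_nonneg_left ?_ hδ.le
    rw [← div_eq_mul_inv, le_div_iff₀ h2, mul_comm]
    exact h1.trans ((le_abs_self K).trans (by linarith))
  · intro x
    have hcs' : HasCompactSupport (fun x => ((g (x / δ) : ℝ) : ℂ)) :=
      hcs.comp_homeomorph (Homeomorph.mulRight₀ δ⁻¹ (inv_ne_zero hδ.ne'))
    have hcd' : ContDiff ℝ ∞ (fun x => ((g (x / δ) : ℝ) : ℂ)) :=
      hcd.comp (contDiff_id.div_const δ)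
    have := SchwartzMap.tsum_eq_tsum_fourier (hcs'.toSchwartzMap hcd') x
    have hl : ∀ m : ℤ, (hcs'.toSchwartzMap hcd') (x + m) = ((g ((x + m) / δ) : ℝ) : ℂ) :=
      fun m => rfl
    simp only [hl] at this
    rw [periodize, Complex.ofReal_tsum, this]
    refine tsum_congr fun m => ?_
    congr 1
    · rw [SchwartzMap.fourier_coe, SchwartzMap.fourier_coe, hGe]
      exact fourier_comp_div (fun x => ((g x : ℝ) : ℂ)) hδ m
    · rw [fourier_coe_apply]
      congr 1
      push_cast
      ring

end Fourier

section BoxEstimate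

/-- The geometric sum bound for exponential sums over an interval. -/
theorem norm_sum_exp_le (θ : ℝ) (hθ : 0 < distNearestInt θ) (lo hi : ℕ) :
    ‖∑ x ∈ Finset.Ioc lo hi, Complex.exp (2 * Real.pi * Complex.I * (x * θ))‖ ≤
      (distNearestInt θ)⁻¹ := by
  set z : ℂ := Complex.exp (2 * Real.pi * Complex.I * θ) with hz
  have hterm : ∀ x : ℕ, Complex.exp (2 * Real.pi * Complex.I * (x * θ)) = z ^ x := by
    intro x
    rw [hz, ← Complex.exp_nat_mul]
    congr 1
    ring
  have hnorm : ‖z‖ = 1 := by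
    rw [hz, show 2 * (Real.pi : ℂ) * Complex.I * θ = ((2 * Real.pi * θ : ℝ) : ℂ) * Complex.I by
      push_cast; ring, Complex.norm_exp_ofReal_mul_I]
  have hlow : 4 * distNearestInt θ ≤ ‖z - 1‖ := by
    have hz' : z = Complex.exp (Complex.I * ((2 * Real.pi * (θ - round θ) : ℝ) : ℂ)) := by
      rw [hz, Complex.exp_eq_exp_iff_exists_int]
      exact ⟨round θ, by push_cast; ring⟩
    rw [hz', Complex.norm_exp_I_mul_ofReal_sub_one, norm_mul, Real.norm_eq_abs, Real.norm_eq_abs,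
      abs_two]
    have habs : |θ - round θ| ≤ 1 / 2 := abs_sub_round θ
    have hs := Real.mul_abs_le_abs_sin (x := 2 * Real.pi * (θ - round θ) / 2) (by
      rw [show 2 * Real.pi * (θ - round θ) / 2 = Real.pi * (θ - round θ) by ring, abs_mul,
        abs_of_pos Real.pi_pos]
      nlinarith [Real.pi_pos])
    have he : 2 / Real.pi * |2 * Real.pi * (θ - round θ) / 2| = 2 * distNearestInt θ := by
      rw [show 2 * Real.pi * (θ - round θ) / 2 = Real.pi * (θ - round θ) by ring, abs_mul,
        abs_of_pos Real.pi_pos, distNearestInt]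
      field_simp
    linarith
  have hzne : z ≠ 1 := by
    intro h
    rw [h, sub_self, norm_zero] at hlow
    linarith
  simp only [hterm]
  rcases le_total hi lo with h | h
  · rw [Finset.Ioc_eq_empty (not_lt.2 h), Finset.sum_empty, norm_zero]
    positivity
  · have hI : Finset.Ioc lo hi = Finset.Ico (lo + 1) (hi + 1) := by
      ext x; simp only [Finset.mem_Ioc, Finset.mem_Ico]; omega
    rw [hI, geom_sum_Ico hzne (by omega), norm_div]
    have hnum : ‖z ^ (hi + 1) - z ^ (lo + 1)‖ ≤ 2 := by
      refine (norm_sub_le _ _).trans ?_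
      rw [norm_pow, norm_pow, hnorm, one_pow, one_pow]
      norm_num
    have hpos : 0 < ‖z - 1‖ := by linarith
    rw [div_le_iff₀ hpos, inv_mul_eq_div, le_div_iff₀ hθ]
    nlinarith

theorem norm_sum_int_exp_le (θ : ℝ) (hθ : 0 < distNearestInt θ) (b : ℕ) :
    ‖∑ x ∈ Finset.Ioc (0 : ℤ) b, Complex.exp (2 * Real.pi * Complex.I * (x * θ))‖ ≤
      (distNearestInt θ)⁻¹ := by
  have h := norm_sum_exp_le θ hθ 0 b
  have hI : Finset.Ioc (0 : ℤ) b = (Finset.Ioc 0 b).map Nat.castEmbedding := by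
    ext x
    simp only [Finset.mem_Ioc, Finset.mem_map, Nat.castEmbedding_apply]
    constructor
    · rintro ⟨h1, h2⟩
      exact ⟨x.toNat, by omega, by omega⟩
    · rintro ⟨y, hy, rfl⟩
      omega
  rw [hI, Finset.sum_map]
  simpa using h

theorem one_add_mul_intSupNorm_le_prod {n : ℕ} {δ : ℝ} (hδ : 0 < δ) (k : Fin n → ℤ) :
    1 + δ * intSupNorm k ≤ ∏ j, (1 + δ * |(k j : ℝ)|) := by
  have hone : ∀ j, 1 ≤ 1 + δ * |(k j : ℝ)| := fun j => by
    have : 0 ≤ δ * |(k j : ℝ)| := by positivity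
    linarith
  have h1 : 1 ≤ ∏ j, (1 + δ * |(k j : ℝ)|) := Finset.one_le_prod fun j _ => hone j
  suffices intSupNorm k ≤ (∏ j, (1 + δ * |(k j : ℝ)|) - 1) / δ by
    rw [le_div_iff₀ hδ] at this
    linarith
  rw [intSupNorm, pi_norm_le_iff_of_nonneg (div_nonneg (by linarith) hδ.le)]
  intro j
  rw [Real.norm_eq_abs, le_div_iff₀ hδ]
  rw [← Finset.mul_prod_erase _ _ (Finset.mem_univ j)]
  have h2 : 1 ≤ ∏ i ∈ Finset.univ.erase j, (1 + δ * |(k i : ℝ)|) :=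
    Finset.one_le_prod fun i _ => hone i
  nlinarith [hone j]

theorem summable_norm_of_le_inv_pow {B : ℕ} (hB : 2 ≤ B) {δ K : ℝ} (hδ : 0 < δ) {a : ℤ → ℂ}
    (ha : ∀ m : ℤ, ‖a m‖ ≤ K * ((1 + δ * |(m : ℝ)|) ^ B)⁻¹) : Summable fun m => ‖a m‖ := by
  have hK : 0 ≤ K := by simpa using (norm_nonneg _).trans (ha 0)
  have hs : Summable fun m : ℤ => K / δ ^ 2 * (1 / (m : ℝ) ^ 2) :=
    (Real.summable_one_div_int_pow.2 one_lt_two).mul_left _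
  refine Summable.of_norm_bounded_eventually hs ?_
  filter_upwards [(Set.finite_singleton (0 : ℤ)).eventually_cofinite_notMem] with m hm
  have hm0 : (m : ℝ) ≠ 0 := by simpa using hm
  have hmpos : 0 < |(m : ℝ)| := abs_pos.2 hm0
  rw [norm_norm]
  refine (ha m).trans ?_
  rw [div_mul_div_comm, mul_one, div_eq_mul_inv]
  refine mul_le_mul_of_nonneg_left (inv_anti₀ (by positivity) ?_) hK
  calc δ ^ 2 * (m : ℝ) ^ 2 = (δ * |(m : ℝ)|) ^ 2 := by rw [mul_pow, sq_abs]
    _ ≤ (1 + δ * |(m : ℝ)|) ^ 2 := pow_le_pow_left₀ (by positivity) (by linarith) 2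
    _ ≤ _ := pow_le_pow_right₀ (by nlinarith [mul_pos hδ hmpos]) hB

theorem sum_mul_vecMul_cons {d n : ℕ} (Θ : Matrix (Fin (d + 1)) (Fin n) ℝ) (k : Fin n → ℤ)
    (q : ℝ) (a : Fin d → ℝ) :
    ∑ j, (k j : ℝ) * Matrix.vecMul (Fin.cons q a : Fin (d + 1) → ℝ) Θ j =
      q * linForm Θ k 0 + ∑ u, a u * linForm Θ k u.succ := by
  simp only [Matrix.vecMul, dotProduct, linForm, Finset.mul_sum]
  rw [Finset.sum_comm, Fin.sum_univ_succ]
  simp only [Fin.cons_zero, Fin.cons_succ]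
  congr 1
  · exact Finset.sum_congr rfl fun j _ => by ring
  · exact Finset.sum_congr rfl fun u _ => Finset.sum_congr rfl fun j _ => by ring

/-- The exponential sum over the box `(lo, hi] × (0, b]^d` with frequency vector `ω`. -/
noncomputable def boxExpSum {d : ℕ} (lo hi b : ℕ) (ω : Fin (d + 1) → ℝ) : ℂ :=
  ∑ p ∈ Finset.Ioc lo hi ×ˢ Fintype.piFinset (fun _ : Fin d => Finset.Ioc (0 : ℤ) b),
    Complex.exp (2 * Real.pi * Complex.I * ((p.1 * ω 0 + ∑ u, p.2 u * ω u.succ : ℝ) : ℂ))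

theorem boxExpSum_zero {d : ℕ} {lo hi : ℕ} (h : lo ≤ hi) (b : ℕ) :
    boxExpSum lo hi b (0 : Fin (d + 1) → ℝ) = ((((hi : ℝ) - lo) * b ^ d : ℝ) : ℂ) := by
  simp [boxExpSum, Nat.cast_sub h]

theorem norm_boxExpSum_le {d : ℕ} (lo hi b : ℕ) (ω : Fin (d + 1) → ℝ)
    (hω : ∀ i, 0 < distNearestInt (ω i)) :
    ‖boxExpSum lo hi b ω‖ ≤ ∏ i, (distNearestInt (ω i))⁻¹ := by
  have hfac : boxExpSum lo hi b ω =
      (∑ x ∈ Finset.Ioc lo hi, Complex.exp (2 * Real.pi * Complex.I * (x * ω 0))) *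
        ∏ u : Fin d, ∑ x ∈ Finset.Ioc (0 : ℤ) b,
          Complex.exp (2 * Real.pi * Complex.I * (x * ω u.succ)) := by
    rw [Finset.prod_univ_sum, Finset.sum_mul_sum, ← Finset.sum_product', boxExpSum]
    refine Finset.sum_congr rfl fun p _ => ?_
    rw [← Complex.exp_sum, ← Complex.exp_add]
    congr 1
    push_cast
    rw [mul_add, Finset.mul_sum]
  rw [hfac, norm_mul, norm_prod, Fin.prod_univ_succ]
  refine mul_le_mul (norm_sum_exp_le _ (hω 0) lo hi)
    (Finset.prod_le_prod (fun _ _ => norm_nonneg _) fun u _ => norm_sum_int_exp_le _ (hω _) b)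
    (Finset.prod_nonneg fun _ _ => norm_nonneg _) (inv_nonneg.2 (hω 0).le)

theorem sum_prod_tsum_eq_tsum_boxExpSum {d n : ℕ} (Θ : Matrix (Fin (d + 1)) (Fin n) ℝ)
    {a : ℤ → ℂ} (ha : Summable fun m => ‖a m‖) {F : ℝ → ℝ}
    (hF : ∀ x : ℝ, ((F x : ℝ) : ℂ) =
      ∑' m : ℤ, a m * Complex.exp (2 * Real.pi * Complex.I * (m * x))) (lo hi b : ℕ) :
    HasSum (fun k : Fin n → ℤ => (∏ j, a (k j)) * boxExpSum lo hi b (linForm Θ k))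
      ((∑ q ∈ Finset.Ioc lo hi, ∑ x ∈ Fintype.piFinset (fun _ : Fin d => Finset.Ioc (0 : ℤ) b),
        ∏ j, F (Matrix.vecMul (Fin.cons (q : ℝ) (fun u => (x u : ℝ))) Θ j) : ℝ) : ℂ) := by
  have hnorm : ∀ (m : ℤ) (x : ℝ),
      ‖a m * Complex.exp (2 * Real.pi * Complex.I * (m * x))‖ = ‖a m‖ := by
    intro m x
    rw [norm_mul, show 2 * (Real.pi : ℂ) * Complex.I * (m * x) =
      ((2 * Real.pi * (m * x) : ℝ) : ℂ) * Complex.I by push_cast; ring,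
      Complex.norm_exp_ofReal_mul_I, mul_one]
  have hpoint : ∀ y : Fin n → ℝ,
      HasSum (fun k : Fin n → ℤ => (∏ j, a (k j)) *
        Complex.exp (2 * Real.pi * Complex.I * ((∑ j, (k j : ℝ) * y j : ℝ) : ℂ)))
        ((∏ j, F (y j) : ℝ) : ℂ) := by
    intro y
    obtain ⟨hs, he⟩ := summable_norm_and_prod_tsum
      (fun j m => a m * Complex.exp (2 * Real.pi * Complex.I * (m * y j)))
      (fun j => by simpa only [hnorm] using ha)
    push_cast
    simp only [hF]
    rw [he]
    refine hs.of_norm.hasSum.congr_fun fun k => ?_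
    rw [Finset.prod_mul_distrib, ← Complex.exp_sum, Finset.mul_sum]
  have hsum := hasSum_sum (s := Finset.Ioc lo hi ×ˢ
      Fintype.piFinset (fun _ : Fin d => Finset.Ioc (0 : ℤ) b))
    fun p _ => hpoint (Matrix.vecMul (Fin.cons (p.1 : ℝ) (fun u => (p.2 u : ℝ))) Θ)
  rw [← Finset.sum_product', Complex.ofReal_sum]
  refine hsum.congr_fun fun k => ?_
  rw [boxExpSum, Finset.mul_sum]
  simp only [sum_mul_vecMul_cons]

/-- The periodized bump function summed over the integer points of a box, up to an error that does
not depend on the box. -/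
theorem exists_box_estimate {d n : ℕ} (hn : 1 ≤ n) {φ : ℝ → ℝ}
    (hφ : ∀ x, 1 ≤ x → 0 < φ x ∧ φ x ≤ 1) (hφmono : ∀ x y, 1 ≤ x → x ≤ y → φ y ≤ φ x)
    {c : ℝ} (hc0 : 0 < c) (hc : ∀ x, 1 ≤ x → c * φ x ≤ φ (2 * x)) (g : ContDiffBump (0 : ℝ)) :
    ∃ C : ℝ, 0 < C ∧ ∀ Θ : Matrix (Fin (d + 1)) (Fin n) ℝ, SemiMultBad φ Θ →
      ∀ δ : ℝ, 0 < δ → δ < 1 / 2 → ∀ lo hi b : ℕ, lo ≤ hi →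
      |(∑ q ∈ Finset.Ioc lo hi, ∑ x ∈ Fintype.piFinset (fun _ : Fin d => Finset.Ioc (0 : ℤ) b),
          ∏ j, periodize g δ (Matrix.vecMul (Fin.cons (q : ℝ) (fun u => (x u : ℝ))) Θ j)) -
        (δ * ∫ x, g x) ^ n * (((hi : ℝ) - lo) * b ^ d)| ≤
        C * (Real.log ((1 / δ ^ n) / φ (1 / δ)) ^ (d + 1) +
          (1 / φ (1 / δ)) * Real.log ((1 / δ ^ n) / φ (1 / δ)) ^ d) := by
  obtain ⟨B, C, hC, hW⟩ := exists_weighted_sum_le (d := d) hn hφ hφmono hc0 hc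
  obtain ⟨C₁, hC₁, hP⟩ := exists_periodize_eq_tsum g (max B 2)
  refine ⟨C₁ ^ n * C, by positivity, fun Θ hΘ δ hδ hδ2 lo hi b hlo => ?_⟩
  obtain ⟨a, ha0, hle, hF⟩ := hP δ hδ
  have hsa := summable_norm_of_le_inv_pow (le_max_right B 2) hδ hle
  have hsum := sum_prod_tsum_eq_tsum_boxExpSum Θ hsa hF lo hi b
  set S : ℝ := ∑ q ∈ Finset.Ioc lo hi,
    ∑ x ∈ Fintype.piFinset (fun _ : Fin d => Finset.Ioc (0 : ℤ) b),
      ∏ j, periodize g δ (Matrix.vecMul (Fin.cons (q : ℝ) (fun u => (x u : ℝ))) Θ j)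
  set h : (Fin n → ℤ) → ℂ := fun k => (∏ j, a (k j)) * boxExpSum lo hi b (linForm Θ k) with hh
  have h0 : h 0 = (((δ * ∫ x, g x) ^ n * (((hi : ℝ) - lo) * b ^ d) : ℝ) : ℂ) := by
    have hz : linForm Θ 0 = (0 : Fin (d + 1) → ℝ) := by
      ext i; simp [linForm]
    simp only [hh, hz, boxExpSum_zero hlo, Pi.zero_apply, ha0]
    rw [Finset.prod_const, Finset.card_univ, Fintype.card_fin]
    push_cast
    rfl
  have hcoef : ∀ k : Fin n → ℤ,
      ‖∏ j, a (k j)‖ ≤ (δ * C₁) ^ n * ((1 + δ * intSupNorm k) ^ B)⁻¹ := by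
    intro k
    have hnn : 0 ≤ δ * intSupNorm k := mul_nonneg hδ.le (norm_nonneg _)
    calc ‖∏ j, a (k j)‖ = ∏ j, ‖a (k j)‖ := norm_prod _ _
      _ ≤ ∏ j, (δ * C₁ * ((1 + δ * |(k j : ℝ)|) ^ (max B 2))⁻¹) :=
        Finset.prod_le_prod (fun _ _ => norm_nonneg _) fun j _ => hle _
      _ = (δ * C₁) ^ n * ((∏ j, (1 + δ * |(k j : ℝ)|)) ^ (max B 2))⁻¹ := by
        rw [Finset.prod_mul_distrib, Finset.prod_const, Finset.card_univ, Fintype.card_fin,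
          Finset.prod_inv_distrib, Finset.prod_pow]
      _ ≤ (δ * C₁) ^ n * ((1 + δ * intSupNorm k) ^ B)⁻¹ := by
        refine mul_le_mul_of_nonneg_left (inv_anti₀ (by positivity) ?_) (by positivity)
        calc (1 + δ * intSupNorm k) ^ B ≤ (1 + δ * intSupNorm k) ^ (max B 2) :=
              pow_le_pow_right₀ (by linarith) (le_max_left _ _)
          _ ≤ _ := pow_le_pow_left₀ (by linarith) (one_add_mul_intSupNorm_le_prod hδ k) _
  have hterm : ∀ k : Fin n → ℤ, k ≠ 0 → ‖h k‖ ≤ (δ * C₁) ^ n *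
      (((1 + δ * intSupNorm k) ^ B)⁻¹ * ∏ i, (distNearestInt (linForm Θ k i))⁻¹) := by
    intro k hk
    rw [hh, norm_mul, ← mul_assoc]
    have hnn : 0 ≤ δ * intSupNorm k := mul_nonneg hδ.le (norm_nonneg _)
    exact mul_le_mul (hcoef k) (norm_boxExpSum_le lo hi b _ fun i =>
      distNearestInt_pos_of_semiMultBad (fun x hx => (hφ x hx).1) hΘ hk i)
      (norm_nonneg _) (by positivity)
  have hS : ((S - (δ * ∫ x, g x) ^ n * (((hi : ℝ) - lo) * b ^ d) : ℝ) : ℂ) = (S : ℂ) - h 0 := by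
    rw [h0]; push_cast; rfl
  rw [← Real.norm_eq_abs, ← Complex.norm_real, hS]
  have hsub := (hsum.sub (hasSum_ite_eq (0 : Fin n → ℤ) (h 0))).norm
  refine le_of_tendsto' hsub fun T => ?_
  have hsplit : ∑ k ∈ T, (h k - if k = 0 then h 0 else 0) = ∑ k ∈ T with k ≠ 0, h k := by
    rw [Finset.sum_filter]
    refine Finset.sum_congr rfl fun k _ => ?_
    by_cases hk : k = 0 <;> simp [hk]
  rw [hsplit]
  calc ‖∑ k ∈ T with k ≠ 0, h k‖ ≤ ∑ k ∈ T with k ≠ 0, ‖h k‖ := norm_sum_le _ _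
    _ ≤ ∑ k ∈ T with k ≠ 0, (δ * C₁) ^ n *
      (((1 + δ * intSupNorm k) ^ B)⁻¹ * ∏ i, (distNearestInt (linForm Θ k i))⁻¹) :=
        Finset.sum_le_sum fun k hk => hterm k (Finset.mem_filter.1 hk).2
    _ ≤ (δ * C₁) ^ n * (C * ((1 / δ ^ n) * (Real.log ((1 / δ ^ n) / φ (1 / δ)) ^ (d + 1) +
          (1 / φ (1 / δ)) * Real.log ((1 / δ ^ n) / φ (1 / δ)) ^ d))) := by
        rw [← Finset.mul_sum]
        exact mul_le_mul_of_nonneg_left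
          (hW Θ hΘ δ hδ hδ2 _ fun k hk => (Finset.mem_filter.1 hk).2) (by positivity)
    _ = _ := by
        rw [mul_pow]
        field_simp

end BoxEstimate

section Periodize

theorem periodize_nonneg (g : ContDiffBump (0 : ℝ)) (δ x : ℝ) : 0 ≤ periodize g δ x :=
  tsum_nonneg fun _ => g.nonneg

theorem bump_apply_eq_zero (g : ContDiffBump (0 : ℝ)) {δ y : ℝ} (hδ : 0 < δ)
    (hy : δ * g.rOut ≤ |y|) : g (y / δ) = 0 := by
  apply g.zero_of_le_dist
  rw [dist_zero_right, Real.norm_eq_abs, abs_div, abs_of_pos hδ, le_div_iff₀ hδ]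
  linarith

theorem one_le_periodize (g : ContDiffBump (0 : ℝ)) (hg : g.rIn = 1) {δ x : ℝ} (hδ : 0 < δ)
    (hx : distNearestInt x < δ) : 1 ≤ periodize g δ x := by
  have hfin : (Function.support fun m : ℤ => g ((x + m) / δ)).Finite := by
    refine (Set.finite_Icc ⌊-x - δ * g.rOut⌋ ⌈-x + δ * g.rOut⌉).subset fun m hm => ?_
    have hlt : |x + m| < δ * g.rOut := by
      by_contra h
      exact hm (bump_apply_eq_zero g hδ (not_lt.1 h))
    obtain ⟨h1, h2⟩ := abs_lt.1 hlt
    constructor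
    · exact_mod_cast (Int.floor_le _).trans (show -x - δ * g.rOut ≤ (m : ℝ) by linarith)
    · exact_mod_cast (show (m : ℝ) ≤ -x + δ * g.rOut by linarith).trans (Int.le_ceil _)
  have hs : Summable fun m : ℤ => g ((x + m) / δ) := summable_of_hasFiniteSupport hfin
  have hone : g ((x + ((-round x : ℤ) : ℝ)) / δ) = 1 := by
    apply g.one_of_mem_closedBall
    rw [Metric.mem_closedBall, dist_zero_right, hg, Real.norm_eq_abs, abs_div, abs_of_pos hδ,
      div_le_one hδ]
    push_cast
    rw [← sub_eq_add_neg]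
    exact hx.le
  rw [← hone]
  exact hs.le_tsum _ fun _ _ => g.nonneg

theorem periodize_eq_single (g : ContDiffBump (0 : ℝ)) (hg : g.rOut = 1) {δ : ℝ} (hδ : 0 < δ)
    (hδ2 : δ < 1 / 2) (x : ℝ) : periodize g δ x = g ((x - round x) / δ) := by
  rw [periodize, tsum_eq_single (-round x)]
  · push_cast
    rw [← sub_eq_add_neg]
  · intro m hm
    apply bump_apply_eq_zero g hδ
    rw [hg, mul_one]
    have h1 : (1 : ℝ) ≤ |((m + round x : ℤ) : ℝ)| := by
      exact_mod_cast Int.one_le_abs (show m + round x ≠ 0 by omega)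
    have h2 : |x - round x| ≤ 1 / 2 := abs_sub_round x
    have h3 : ((m + round x : ℤ) : ℝ) = (x + m) - (x - round x) := by push_cast; ring
    rw [h3] at h1
    linarith [abs_sub (x + (m : ℝ)) (x - round x)]

theorem exists_bump_majorant (n : ℕ) {ε : ℝ} (hε : 0 < ε) :
    ∃ g : ContDiffBump (0 : ℝ), g.rIn = 1 ∧ (∫ x, g x) ^ n ≤ 2 ^ n + ε := by
  have hcont : Filter.Tendsto (fun t : ℝ => (2 * (1 + t)) ^ n) (nhdsWithin 0 (Set.Ioi 0))
      (nhds (2 ^ n)) := by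
    have : Continuous fun t : ℝ => (2 * (1 + t)) ^ n := by fun_prop
    simpa using (this.tendsto 0).mono_left nhdsWithin_le_nhds
  obtain ⟨t, ht, ht0⟩ := ((hcont.eventually (gt_mem_nhds (show (2 : ℝ) ^ n < 2 ^ n + ε by
    linarith))).and self_mem_nhdsWithin).exists
  have ht0 : 0 < t := ht0
  refine ⟨⟨1, 1 + t, one_pos, by linarith⟩, rfl, le_trans ?_ ht.le⟩
  refine pow_le_pow_left₀ (MeasureTheory.integral_nonneg fun x => ContDiffBump.nonneg _) ?_ n
  refine (ContDiffBump.integral_le_measure_closedBall _ MeasureTheory.volume).trans (le_of_eq ?_)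
  rw [MeasureTheory.measureReal_def, Real.volume_closedBall,
    ENNReal.toReal_ofReal (by simp; linarith)]

theorem exists_bump_minorant (n : ℕ) {ε : ℝ} (hε : 0 < ε) :
    ∃ g : ContDiffBump (0 : ℝ), g.rOut = 1 ∧ 2 ^ n - ε ≤ (∫ x, g x) ^ n := by
  have hcont : Filter.Tendsto (fun t : ℝ => (2 * (1 - t)) ^ n) (nhdsWithin 0 (Set.Ioi 0))
      (nhds (2 ^ n)) := by
    have : Continuous fun t : ℝ => (2 * (1 - t)) ^ n := by fun_prop
    simpa using (this.tendsto 0).mono_left nhdsWithin_le_nhds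
  obtain ⟨t, ⟨ht, ht0⟩, ht1⟩ := (((hcont.eventually (lt_mem_nhds
    (show (2 : ℝ) ^ n - ε < 2 ^ n by linarith))).and self_mem_nhdsWithin).and
    (nhdsWithin_le_nhds (gt_mem_nhds (show (0 : ℝ) < 1 by norm_num)))).exists
  have ht0 : 0 < t := ht0
  have ht1 : t < 1 := ht1
  refine ⟨⟨1 - t, 1, by linarith, by linarith⟩, rfl, ht.le.trans ?_⟩
  refine pow_le_pow_left₀ (by linarith) ?_ n
  refine le_trans (le_of_eq ?_)
    (ContDiffBump.measure_closedBall_le_integral _ MeasureTheory.volume)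
  rw [MeasureTheory.measureReal_def, Real.volume_closedBall,
    ENNReal.toReal_ofReal (by simp; linarith)]

end Periodize

section Dissection

theorem sum_Ioc_eq_sum_blocks (f : ℕ → ℝ) {b : ℕ → ℕ} (hb : Monotone b) (R : ℕ) :
    ∑ q ∈ Finset.Ioc (b 0) (b R), f q =
      ∑ t ∈ Finset.range R, ∑ q ∈ Finset.Ioc (b t) (b (t + 1)), f q := by
  induction R with
  | zero => simp
  | succ R ih =>
    rw [Finset.sum_range_succ, ← ih,
      Finset.sum_Ioc_consecutive f (hb (Nat.zero_le R)) (hb (Nat.le_succ R))]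

/-- A sum over `(0, Q]` is estimated by cutting the interval into `R` blocks of nearly equal
length. -/
theorem abs_sum_sub_le_of_block_bounds {d : ℕ} {T : ℕ → ℝ} {D η E : ℝ} (hD : 0 ≤ D)
    (hη : 0 ≤ η)
    (hup : ∀ lo hi : ℕ, lo ≤ hi →
      ∑ q ∈ Finset.Ioc lo hi, T q ≤ (D + η) * (((hi : ℝ) - lo) * hi ^ d) + E)
    (hlow : ∀ lo hi : ℕ, lo ≤ hi →
      (D - η) * (((hi : ℝ) - lo) * lo ^ d) - E ≤ ∑ q ∈ Finset.Ioc lo hi, T q)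
    {R : ℕ} (hR : 1 ≤ R) (Q : ℕ) :
    |∑ q ∈ Finset.Ioc 0 Q, T q - D * ∑ q ∈ Finset.Ioc 0 Q, (q : ℝ) ^ d| ≤
      D * (2 * (Q : ℝ) ^ (d + 1) / R + R ^ d) + η * (Q : ℝ) ^ (d + 1) + R * E := by
  set b : ℕ → ℕ := fun t => Q * t / R with hb
  have hmono : Monotone b := fun s t h => Nat.div_le_div_right (Nat.mul_le_mul_left Q h)
  have hR0 : (0 : ℝ) < R := by exact_mod_cast hR
  have hb0 : b 0 = 0 := by simp [hb]
  have hbR : b R = Q := by simp [hb, Nat.mul_div_cancel _ hR]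
  have hstep : ∀ t, (b (t + 1) : ℝ) - b t ≤ Q / R + 1 := by
    intro t
    have h1 : (b (t + 1) : ℝ) ≤ (Q * (t + 1) : ℝ) / R := by
      have := @Nat.cast_div_le ℝ _ _ _ (Q * (t + 1)) R
      push_cast at this
      exact this
    have h2 : (Q * t : ℝ) / R < b t + 1 := by
      rw [div_lt_iff₀ hR0]
      have := Nat.lt_mul_div_succ (Q * t) (show 0 < R by omega)
      rw [mul_comm R] at this
      exact_mod_cast this
    have h3 : (Q * (t + 1) : ℝ) / R = Q * t / R + Q / R := by ring
    linarith
  have hle : ∀ t, (b t : ℝ) ≤ b (t + 1) := fun t => by exact_mod_cast hmono (Nat.le_succ t)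
  have hbQ : ∀ t ≤ R, (b t : ℝ) ≤ Q := fun t ht => by
    rw [← hbR]; exact_mod_cast hmono ht
  set U : ℝ := ∑ t ∈ Finset.range R, ((b (t + 1) : ℝ) - b t) * (b (t + 1) : ℝ) ^ d with hU
  set V : ℝ := ∑ t ∈ Finset.range R, ((b (t + 1) : ℝ) - b t) * (b t : ℝ) ^ d with hV
  have hV0 : 0 ≤ V := Finset.sum_nonneg fun t _ =>
    mul_nonneg (sub_nonneg.2 (hle t)) (by positivity)
  have hVU : V ≤ U := Finset.sum_le_sum fun t _ =>
    mul_le_mul_of_nonneg_left (pow_le_pow_left₀ (by positivity) (hle t) d)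
      (sub_nonneg.2 (hle t))
  have hUQ : U ≤ (Q : ℝ) ^ (d + 1) := by
    calc U ≤ ∑ t ∈ Finset.range R, ((b (t + 1) : ℝ) - b t) * (Q : ℝ) ^ d :=
          Finset.sum_le_sum fun t ht => mul_le_mul_of_nonneg_left
            (pow_le_pow_left₀ (by positivity) (hbQ _ (Finset.mem_range.1 ht)) d)
            (sub_nonneg.2 (hle t))
      _ = (Q : ℝ) ^ (d + 1) := by
          rw [← Finset.sum_mul, Finset.sum_range_sub (fun t => (b t : ℝ)), hb0, hbR]
          push_cast
          ring
  have hQR : (Q : ℝ) ^ d ≤ (Q : ℝ) ^ (d + 1) / R + R ^ d := by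
    rcases le_total (R : ℝ) Q with h | h
    · have : (Q : ℝ) ^ d ≤ (Q : ℝ) ^ (d + 1) / R := by
        rw [le_div_iff₀ hR0, pow_succ]
        exact mul_le_mul_of_nonneg_left h (by positivity)
      have : (0 : ℝ) ≤ (R : ℝ) ^ d := by positivity
      linarith
    · have : (Q : ℝ) ^ d ≤ (R : ℝ) ^ d := pow_le_pow_left₀ (by positivity) h d
      have : (0 : ℝ) ≤ (Q : ℝ) ^ (d + 1) / R := by positivity
      linarith
  have hUV : U - V ≤ 2 * (Q : ℝ) ^ (d + 1) / R + R ^ d := by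
    calc U - V = ∑ t ∈ Finset.range R,
          ((b (t + 1) : ℝ) - b t) * ((b (t + 1) : ℝ) ^ d - (b t : ℝ) ^ d) := by
          rw [hU, hV, ← Finset.sum_sub_distrib]
          exact Finset.sum_congr rfl fun t _ => by ring
      _ ≤ ∑ t ∈ Finset.range R, ((Q : ℝ) / R + 1) * ((b (t + 1) : ℝ) ^ d - (b t : ℝ) ^ d) :=
          Finset.sum_le_sum fun t _ => mul_le_mul_of_nonneg_right (hstep t)
            (sub_nonneg.2 (pow_le_pow_left₀ (by positivity) (hle t) d))
      _ = ((Q : ℝ) / R + 1) * ((Q : ℝ) ^ d - 0 ^ d) := by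
          rw [← Finset.mul_sum, Finset.sum_range_sub (fun t => (b t : ℝ) ^ d), hb0, hbR]
          simp
      _ ≤ ((Q : ℝ) / R + 1) * (Q : ℝ) ^ d :=
          mul_le_mul_of_nonneg_left (by simp) (by positivity)
      _ = (Q : ℝ) ^ (d + 1) / R + (Q : ℝ) ^ d := by ring
      _ ≤ _ := by
          rw [show 2 * (Q : ℝ) ^ (d + 1) / R =
            (Q : ℝ) ^ (d + 1) / R + (Q : ℝ) ^ (d + 1) / R by ring]
          linarith
  have hpow_up : ∑ q ∈ Finset.Ioc 0 Q, (q : ℝ) ^ d ≤ U := by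
    rw [← hbR, ← hb0, sum_Ioc_eq_sum_blocks _ hmono]
    refine Finset.sum_le_sum fun t _ => ?_
    refine (Finset.sum_le_card_nsmul _ _ ((b (t + 1) : ℝ) ^ d) fun q hq => ?_).trans (le_of_eq ?_)
    · exact pow_le_pow_left₀ (by positivity) (by exact_mod_cast (Finset.mem_Ioc.1 hq).2) d
    · rw [Nat.card_Ioc, nsmul_eq_mul, Nat.cast_sub (hmono (Nat.le_succ t))]
  have hpow_low : V ≤ ∑ q ∈ Finset.Ioc 0 Q, (q : ℝ) ^ d := by
    rw [← hbR, ← hb0, sum_Ioc_eq_sum_blocks _ hmono]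
    refine Finset.sum_le_sum fun t _ => ?_
    refine le_trans (le_of_eq ?_)
      (Finset.card_nsmul_le_sum _ _ ((b t : ℝ) ^ d) fun q hq => ?_)
    · rw [Nat.card_Ioc, nsmul_eq_mul, Nat.cast_sub (hmono (Nat.le_succ t))]
    · exact pow_le_pow_left₀ (by positivity) (by exact_mod_cast (Finset.mem_Ioc.1 hq).1.le) d
  have hT_up : ∑ q ∈ Finset.Ioc 0 Q, T q ≤ (D + η) * U + R * E := by
    rw [← hbR, ← hb0, sum_Ioc_eq_sum_blocks _ hmono]
    refine (Finset.sum_le_sum fun t _ => hup _ _ (hmono (Nat.le_succ t))).trans (le_of_eq ?_)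
    rw [Finset.sum_add_distrib, ← Finset.mul_sum, Finset.sum_const, Finset.card_range,
      nsmul_eq_mul]
  have hT_low : (D - η) * V - R * E ≤ ∑ q ∈ Finset.Ioc 0 Q, T q := by
    rw [← hbR, ← hb0, sum_Ioc_eq_sum_blocks _ hmono]
    refine le_trans (le_of_eq ?_) (Finset.sum_le_sum fun t _ =>
      hlow _ _ (hmono (Nat.le_succ t)))
    rw [Finset.sum_sub_distrib, ← Finset.mul_sum, Finset.sum_const, Finset.card_range,
      nsmul_eq_mul]
  have hDUV := mul_le_mul_of_nonneg_left hUV hD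
  have hηU := mul_le_mul_of_nonneg_left hUQ hη
  have hηV := mul_le_mul_of_nonneg_left hVU hη
  have hD1 := mul_le_mul_of_nonneg_left hpow_up hD
  have hD2 := mul_le_mul_of_nonneg_left hpow_low hD
  rw [abs_le]
  constructor <;> nlinarith

end Dissection

section Counting

theorem setOf_box_eq {d : ℕ} (q : ℕ) (P : (Fin d → ℤ) → Prop) [DecidablePred P] :
    {a : Fin d → ℤ | (∀ u, 0 < a u ∧ a u ≤ (q : ℤ)) ∧ P a} =
      ((Fintype.piFinset fun _ : Fin d => Finset.Ioc (0 : ℤ) q).filter P : Set (Fin d → ℤ)) := by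
  ext a
  simp [Fintype.mem_piFinset]

theorem ncard_le_sum_prod {d n q b : ℕ} (hqb : q ≤ b) {δ : ℝ} {F : ℝ → ℝ}
    (hF0 : ∀ x, 0 ≤ F x) (hF1 : ∀ x, distNearestInt x < δ → 1 ≤ F x)
    (y : (Fin d → ℤ) → Fin n → ℝ) :
    (Set.ncard {a : Fin d → ℤ | (∀ u, 0 < a u ∧ a u ≤ (q : ℤ)) ∧
        ∀ j, distNearestInt (y a j) < δ} : ℝ) ≤
      ∑ a ∈ Fintype.piFinset (fun _ : Fin d => Finset.Ioc (0 : ℤ) b), ∏ j, F (y a j) := by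
  classical
  rw [setOf_box_eq, Set.ncard_coe_finset, Finset.card_eq_sum_ones, Nat.cast_sum]
  have hsub : (Fintype.piFinset fun _ : Fin d => Finset.Ioc (0 : ℤ) q).filter
      (fun a => ∀ j, distNearestInt (y a j) < δ) ⊆
      Fintype.piFinset (fun _ : Fin d => Finset.Ioc (0 : ℤ) b) :=
    (Finset.filter_subset _ _).trans (Fintype.piFinset_subset _ _ fun _ =>
      Finset.Ioc_subset_Ioc_right (by exact_mod_cast hqb))
  refine le_trans (Finset.sum_le_sum fun a ha => ?_)
    (Finset.sum_le_sum_of_subset_of_nonneg hsub fun a _ _ => Finset.prod_nonneg fun j _ => hF0 _)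
  rw [Nat.cast_one]
  exact Finset.one_le_prod fun j _ => hF1 _ ((Finset.mem_filter.1 ha).2 j)

theorem sum_prod_le_ncard {d n q b : ℕ} (hbq : b ≤ q) {δ : ℝ} {F : ℝ → ℝ}
    (hF0 : ∀ x, 0 ≤ F x) (hF1 : ∀ x, F x ≤ 1) (hFz : ∀ x, δ ≤ distNearestInt x → F x = 0)
    (y : (Fin d → ℤ) → Fin n → ℝ) :
    ∑ a ∈ Fintype.piFinset (fun _ : Fin d => Finset.Ioc (0 : ℤ) b), ∏ j, F (y a j) ≤
      (Set.ncard {a : Fin d → ℤ | (∀ u, 0 < a u ∧ a u ≤ (q : ℤ)) ∧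
        ∀ j, distNearestInt (y a j) < δ} : ℝ) := by
  classical
  rw [setOf_box_eq, Set.ncard_coe_finset, Finset.card_eq_sum_ones, Nat.cast_sum,
    Finset.sum_filter]
  have hsub : Fintype.piFinset (fun _ : Fin d => Finset.Ioc (0 : ℤ) b) ⊆
      Fintype.piFinset fun _ : Fin d => Finset.Ioc (0 : ℤ) q :=
    Fintype.piFinset_subset _ _ fun _ => Finset.Ioc_subset_Ioc_right (by exact_mod_cast hbq)
  refine le_trans (Finset.sum_le_sum fun a _ => ?_)
    (Finset.sum_le_sum_of_subset_of_nonneg hsub fun a _ _ => by positivity)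
  split_ifs with h
  · rw [Nat.cast_one]
    exact Finset.prod_le_one (fun j _ => hF0 _) fun j _ => hF1 _
  · push Not at h
    obtain ⟨j, hj⟩ := h
    exact (Finset.prod_eq_zero (Finset.mem_univ j) (hFz _ hj)).le

end Counting

/-- **Lemma 7.1** (refined version of Huang–Liu, Theorem 8): asymptotic count of
`𝒩(Q,δ) = Σ_{q=1}^Q 𝒜(q,δ)` for a `φ̃`-semi multiplicatively badly approximable `Ã`. -/
theorem count_rational_points_near_subspace_sum (N d : ℕ) (hd : 1 ≤ d) (hdN : d < N)
    (φt : ℝ → ℝ) (hφ01 : ∀ x, 1 ≤ x → 0 < φt x ∧ φt x ≤ 1)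
    (hφmono : ∀ x y, 1 ≤ x → x ≤ y → φt y ≤ φt x)
    (hφlam : ∀ lam : ℝ, 1 ≤ lam → ∃ clam : ℝ, 0 < clam ∧
      ∀ x : ℝ, 1 ≤ x → clam * φt x ≤ φt (lam * x)) :
    ∀ ε' : ℝ, 0 < ε' → ∃ C : ℝ, 0 < C ∧
      ∀ (A : Matrix (Fin d) (Fin (N - d)) ℝ) (α₀ : Fin (N - d) → ℝ)
        (Atil : Matrix (Fin (d + 1)) (Fin (N - d)) ℝ),
        Atil = Matrix.of (Fin.cons α₀ (fun i => A i)) →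
        -- `Ã` is `φ̃`-semi multiplicatively badly approximable
        (∀ q : Fin (N - d) → ℤ, q ≠ 0 →
          φt (intSupNorm q) ≤ intSupNorm q ^ (N - d) *
            ∏ i, distNearestInt (∑ j, Atil i j * (q j : ℝ))) →
      ∀ Q : ℕ, 1 ≤ Q → ∀ δ : ℝ, 0 < δ → δ < 1 / 2 →
        abs ((∑ q ∈ Finset.Icc 1 Q,
              (Set.ncard {a : Fin d → ℤ | (∀ u, 0 < a u ∧ a u ≤ (q : ℤ)) ∧
                ∀ j, distNearestInt
                  (Matrix.vecMul (Fin.cons (q : ℝ) (fun u => (a u : ℝ))) Atil j) < δ} : ℝ)) -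
            2 ^ (N - d) * δ ^ (N - d) * ∑ q ∈ Finset.Icc 1 Q, (q : ℝ) ^ d) ≤
          ε' * δ ^ (N - d) * (Q : ℝ) ^ (d + 1) +
            C * (Real.log ((1 / δ ^ (N - d)) / φt (1 / δ)) ^ (d + 1) +
              (1 / φt (1 / δ)) * Real.log ((1 / δ ^ (N - d)) / φt (1 / δ)) ^ d) := by
  intro ε' hε'
  obtain ⟨n, hn⟩ : ∃ n, N - d = n := ⟨_, rfl⟩
  have hn1 : 1 ≤ n := by omega
  rw [hn]
  obtain ⟨c, hc0, hc⟩ := hφlam 2 one_le_two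
  obtain ⟨gu, hgu, hgui⟩ := exists_bump_majorant n (half_pos hε')
  obtain ⟨gl, hgl, hgli⟩ := exists_bump_minorant n (half_pos hε')
  obtain ⟨Cu, hCu, hboxu⟩ := exists_box_estimate (d := d) hn1 hφ01 hφmono hc0 hc gu
  obtain ⟨Cl, hCl, hboxl⟩ := exists_box_estimate (d := d) hn1 hφ01 hφmono hc0 hc gl
  obtain ⟨R, hR⟩ := exists_nat_gt (2 ^ n * 2 / (ε' / 2))
  have hR0 : (0 : ℝ) < R := lt_trans (by positivity) hR
  have hR1 : 1 ≤ R := by exact_mod_cast hR0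
  have hlog2 : 0 < Real.log 2 := Real.log_pos one_lt_two
  refine ⟨2 ^ n * R ^ d / Real.log 2 ^ (d + 1) + R * (Cu + Cl), by positivity, ?_⟩
  intro A α₀ Θ _ hΘ Q _ δ hδ hδ2
  have hΘ' : SemiMultBad φt Θ := hΘ
  have hδ1 : 1 ≤ 1 / δ := by rw [le_div_iff₀ hδ]; linarith
  obtain ⟨hφ0, hφ1⟩ := hφ01 (1 / δ) hδ1
  set L : ℝ := Real.log ((1 / δ ^ n) / φt (1 / δ)) with hL
  set W : ℝ := L ^ (d + 1) + (1 / φt (1 / δ)) * L ^ d with hW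
  have hδn : 0 < δ ^ n := by positivity
  have hδnle : δ ^ n ≤ 1 / 2 :=
    (pow_le_of_le_one hδ.le (by linarith) (by omega)).trans hδ2.le
  have hLlog : Real.log 2 ≤ L := by
    refine Real.log_le_log two_pos ?_
    rw [le_div_iff₀ hφ0, le_div_iff₀ hδn]
    nlinarith
  have hL0 : 0 < L := hlog2.trans_le hLlog
  have hWlow : Real.log 2 ^ (d + 1) ≤ W := by
    have h1 : Real.log 2 ^ (d + 1) ≤ L ^ (d + 1) := pow_le_pow_left₀ hlog2.le hLlog _
    have h2 : 0 ≤ (1 / φt (1 / δ)) * L ^ d := by positivity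
    linarith
  have hW0 : 0 < W := (pow_pos hlog2 _).trans_le hWlow
  have hIcc : Finset.Icc 1 Q = Finset.Ioc 0 Q := by
    ext x; simp only [Finset.mem_Icc, Finset.mem_Ioc]; omega
  rw [hIcc]
  set T : ℕ → ℝ := fun q => (Set.ncard {a : Fin d → ℤ | (∀ u, 0 < a u ∧ a u ≤ (q : ℤ)) ∧
    ∀ j, distNearestInt
      (Matrix.vecMul (Fin.cons (q : ℝ) (fun u => (a u : ℝ))) Θ j) < δ} : ℝ)
  have hup : ∀ lo hi : ℕ, lo ≤ hi → ∑ q ∈ Finset.Ioc lo hi, T q ≤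
      (2 ^ n * δ ^ n + ε' / 2 * δ ^ n) * (((hi : ℝ) - lo) * hi ^ d) + (Cu + Cl) * W := by
    intro lo hi hlo
    have hbox := (abs_le.1 (hboxu Θ hΘ' δ hδ hδ2 lo hi hi hlo)).2
    have hvol : 0 ≤ ((hi : ℝ) - lo) * hi ^ d :=
      mul_nonneg (sub_nonneg.2 (by exact_mod_cast hlo)) (by positivity)
    have hmain : (δ * ∫ x, gu x) ^ n * (((hi : ℝ) - lo) * hi ^ d) ≤
        (2 ^ n * δ ^ n + ε' / 2 * δ ^ n) * (((hi : ℝ) - lo) * hi ^ d) := by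
      refine mul_le_mul_of_nonneg_right ?_ hvol
      rw [mul_pow]
      nlinarith
    have hT := Finset.sum_le_sum fun q (hq : q ∈ Finset.Ioc lo hi) =>
      ncard_le_sum_prod (Finset.mem_Ioc.1 hq).2 (periodize_nonneg gu δ)
        (fun x hx => one_le_periodize gu hgu hδ hx)
        (fun a => Matrix.vecMul (Fin.cons (q : ℝ) (fun u : Fin d => (a u : ℝ))) Θ)
    have hClW : 0 ≤ Cl * W := by positivity
    linarith
  have hlow : ∀ lo hi : ℕ, lo ≤ hi →
      (2 ^ n * δ ^ n - ε' / 2 * δ ^ n) * (((hi : ℝ) - lo) * lo ^ d) - (Cu + Cl) * W ≤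
        ∑ q ∈ Finset.Ioc lo hi, T q := by
    intro lo hi hlo
    have hbox := (abs_le.1 (hboxl Θ hΘ' δ hδ hδ2 lo hi lo hlo)).1
    have hvol : 0 ≤ ((hi : ℝ) - lo) * lo ^ d :=
      mul_nonneg (sub_nonneg.2 (by exact_mod_cast hlo)) (by positivity)
    have hmain : (2 ^ n * δ ^ n - ε' / 2 * δ ^ n) * (((hi : ℝ) - lo) * lo ^ d) ≤
        (δ * ∫ x, gl x) ^ n * (((hi : ℝ) - lo) * lo ^ d) := by
      refine mul_le_mul_of_nonneg_right ?_ hvol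
      rw [mul_pow]
      nlinarith
    have hT := Finset.sum_le_sum fun q (hq : q ∈ Finset.Ioc lo hi) =>
      sum_prod_le_ncard (δ := δ) (Finset.mem_Ioc.1 hq).1.le (periodize_nonneg gl δ)
        (fun x => by rw [periodize_eq_single gl hgl hδ hδ2]; exact gl.le_one)
        (fun x hx => by
          rw [periodize_eq_single gl hgl hδ hδ2]
          exact bump_apply_eq_zero gl hδ (by rw [hgl, mul_one]; exact hx))
        (fun a => Matrix.vecMul (Fin.cons (q : ℝ) (fun u : Fin d => (a u : ℝ))) Θ)
    have hCuW : 0 ≤ Cu * W := by positivity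
    linarith
  refine (abs_sum_sub_le_of_block_bounds (by positivity) (by positivity) hup hlow hR1 Q).trans ?_
  have hQR : 2 ^ n * δ ^ n * (2 * (Q : ℝ) ^ (d + 1) / R) ≤
      ε' / 2 * δ ^ n * (Q : ℝ) ^ (d + 1) := by
    have h1 : 2 ^ n * 2 / (R : ℝ) ≤ ε' / 2 := by
      rw [div_le_iff₀ hR0]
      rw [div_lt_iff₀ (by positivity)] at hR
      linarith
    calc 2 ^ n * δ ^ n * (2 * (Q : ℝ) ^ (d + 1) / R)
        = 2 ^ n * 2 / (R : ℝ) * (δ ^ n * (Q : ℝ) ^ (d + 1)) := by ring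
      _ ≤ ε' / 2 * (δ ^ n * (Q : ℝ) ^ (d + 1)) := mul_le_mul_of_nonneg_right h1 (by positivity)
      _ = _ := by ring
  have hconst : 2 ^ n * δ ^ n * (R : ℝ) ^ d ≤ 2 ^ n * R ^ d / Real.log 2 ^ (d + 1) * W := by
    have h1 : 2 ^ n * δ ^ n * (R : ℝ) ^ d ≤ 2 ^ n * R ^ d := by
      have : 0 ≤ (2 : ℝ) ^ n * (R : ℝ) ^ d := by positivity
      nlinarith
    refine h1.trans ?_
    rw [div_mul_eq_mul_div, le_div_iff₀ (by positivity)]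
    exact mul_le_mul_of_nonneg_left hWlow (by positivity)
  linarith
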